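/- arXiv:1601.02862 — 4 statements merged into one kernel-verified Lean document; each statement's English description precedes it below -/
import Mathlib

section
/- Let f : [0,1]² → ℝ be such that the partial derivatives f'_x and f'_y exist at every point of [0,1]², and let E ⊆ [0,1]² be a set of positive two-dimensional Lebesgue measure such that at every point of E all four Dini derivative numbers of f'_x with respect to x, of f'_x with respect to y, of f'_y with respect to x, and of f'_y with respect to y are finite. Then at almost every point of E the mixed second partial derivatives f''_{xy} and f''_{yx} exist and are equal. -/
open MeasureTheory Set Filter

/-- The four Dini derivative numbers of `g` at `s` (taken relative to the domain `[0,1]`,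
i.e. along increments `t` with `s + t ∈ [0,1]`) are all finite: the two limsups
(as `t → 0⁺` and `t → 0⁻`) are `< +∞` and the two liminfs are `> −∞`. -/
def DiniFinite (g : ℝ → ℝ) (s : ℝ) : Prop :=
  limsup (fun t => (((g (s + t) - g s) / t : ℝ) : EReal))
      (nhdsWithin 0 {t : ℝ | 0 < t ∧ s + t ∈ Icc (0:ℝ) 1}) < ⊤ ∧
  ⊥ < liminf (fun t => (((g (s + t) - g s) / t : ℝ) : EReal))
      (nhdsWithin 0 {t : ℝ | 0 < t ∧ s + t ∈ Icc (0:ℝ) 1}) ∧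
  limsup (fun t => (((g (s + t) - g s) / t : ℝ) : EReal))
      (nhdsWithin 0 {t : ℝ | t < 0 ∧ s + t ∈ Icc (0:ℝ) 1}) < ⊤ ∧
  ⊥ < liminf (fun t => (((g (s + t) - g s) / t : ℝ) : EReal))
      (nhdsWithin 0 {t : ℝ | t < 0 ∧ s + t ∈ Icc (0:ℝ) 1})


open scoped Topology ENNReal

theorem analytic_inner {α : Type*} [TopologicalSpace α] [T2Space α] [MeasurableSpace α]
    [BorelSpace α] (μ : Measure α) [IsFiniteMeasure μ] [μ.OuterRegular] {s : Set α}
    (hs : AnalyticSet s) {c : ℝ≥0∞} (hc : c < μ s) :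
    ∃ K, K ⊆ s ∧ IsCompact K ∧ c ≤ μ K := by
  rw [AnalyticSet] at hs
  rcases hs with rfl | ⟨f, hf, rfl⟩
  · simp at hc
  have step : ∀ (k : ℕ) (S : {S : Set (ℕ → ℕ) // c < μ (f '' S)}),
      ∃ m : ℕ, c < μ (f '' (S.1 ∩ {σ | σ k ≤ m})) := by
    rintro k ⟨S, hS⟩
    have hU : f '' S = ⋃ m : ℕ, f '' (S ∩ {σ | σ k ≤ m}) := by
      rw [← image_iUnion, ← inter_iUnion]
      congr 1
      ext σ
      simp only [mem_inter_iff, mem_iUnion, mem_ofPred_eq]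
      exact ⟨fun h => ⟨h, σ k, le_rfl⟩, fun h => h.1⟩
    have hmono : Monotone (fun m : ℕ => f '' (S ∩ {σ : ℕ → ℕ | σ k ≤ m})) := by
      intro a b hab
      apply image_mono
      rintro σ ⟨h1, h2⟩
      exact ⟨h1, le_trans h2 hab⟩
    rw [hU, hmono.measure_iUnion] at hS
    exact lt_iSup_iff.1 hS
  choose m hm using step
  let T : ℕ → {S : Set (ℕ → ℕ) // c < μ (f '' S)} := fun n =>
    Nat.rec ⟨univ, by rwa [image_univ]⟩ (fun k S => ⟨S.1 ∩ {σ | σ k ≤ m k S}, hm k S⟩) n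
  let N : ℕ → ℕ := fun k => m k (T k)
  have hT : ∀ k, (T k).1 = {σ | ∀ i < k, σ i ≤ N i} := by
    intro k
    induction k with
    | zero => ext σ; simp [T]
    | succ k ih =>
      have : (T (k+1)).1 = (T k).1 ∩ {σ | σ k ≤ N k} := rfl
      rw [this, ih]
      ext σ
      simp only [mem_inter_iff, mem_ofPred_eq]
      constructor
      · rintro ⟨h1, h2⟩ i hi
        rcases Nat.lt_succ_iff_lt_or_eq.1 hi with h | rfl
        · exact h1 i h
        · exact h2
      · intro h
        exact ⟨fun i hi => h i (by omega), h k (by omega)⟩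
  let K : Set (ℕ → ℕ) := Set.pi univ (fun i => Iic (N i))
  have hK : IsCompact K := isCompact_univ_pi (fun i => (finite_Iic (N i)).isCompact)
  refine ⟨f '' K, image_subset_range _ _, hK.image hf, ?_⟩
  rw [Set.measure_eq_iInf_isOpen (f '' K) μ]
  refine le_iInf fun U => le_iInf fun hU => le_iInf fun hUo => ?_
  have : ∃ k, f '' (T k).1 ⊆ U := by
    by_contra! hcon
    have : ∀ k, ∃ σ ∈ (T k).1, f σ ∉ U := by
      intro k
      obtain ⟨_, ⟨σ, hσ, rfl⟩, h⟩ := not_subset.1 (hcon k)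
      exact ⟨σ, hσ, h⟩
    choose σ hσ hσU using this
    have hτ : ∀ k, (fun i => min (σ k i) (N i)) ∈ K := fun k i _ => mem_Iic.2 (min_le_right _ _)
    obtain ⟨τ, hτK, φ, hφ, hlim⟩ := hK.tendsto_subseq hτ
    have hlim2 : Tendsto (fun k => σ (φ k)) atTop (𝓝 τ) := by
      rw [tendsto_pi_nhds] at hlim ⊢
      intro i
      refine (hlim i).congr' ?_
      filter_upwards [eventually_gt_atTop i] with k hk
      have h1 := hσ (φ k)
      rw [hT] at h1
      simp only [Function.comp]
      exact min_eq_left (h1 i (lt_of_lt_of_le hk (hφ.id_le k)))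
    have hcl : IsClosed (f ⁻¹' U)ᶜ := (hUo.preimage hf).isClosed_compl
    have : τ ∈ (f ⁻¹' U)ᶜ := hcl.mem_of_tendsto hlim2 (Eventually.of_forall fun k => hσU (φ k))
    exact this (hU ⟨τ, hτK, rfl⟩)
  obtain ⟨k, hk⟩ := this
  exact (T k).2.le.trans (measure_mono hk)

theorem analytic_nullMeasurable {α : Type*} [TopologicalSpace α] [T2Space α] [MeasurableSpace α]
    [BorelSpace α] (μ : Measure α) [IsFiniteMeasure μ] [μ.OuterRegular] {s : Set α}
    (hs : AnalyticSet s) : NullMeasurableSet s μ := by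
  have h : ∀ n : ℕ, ∃ K, K ⊆ s ∧ IsCompact K ∧ μ s ≤ μ K + ((n : ℝ≥0∞) + 1)⁻¹ := by
    intro n
    by_cases h0 : μ s = 0
    · exact ⟨∅, empty_subset _, isCompact_empty, by simp [h0]⟩
    · obtain ⟨K, h1, h2, h3⟩ := analytic_inner μ hs (c := μ s - ((n : ℝ≥0∞) + 1)⁻¹)
        (ENNReal.sub_lt_self (measure_ne_top _ _) h0 (ENNReal.inv_ne_zero.2 (by finiteness)))
      exact ⟨K, h1, h2, tsub_le_iff_right.1 h3⟩
  choose K h1 h2 h3 using h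
  have hm : MeasurableSet (⋃ n, K n) := MeasurableSet.iUnion fun n => (h2 n).measurableSet
  have hsub : (⋃ n, K n) ⊆ s := iUnion_subset h1
  have hz : μ (s \ ⋃ n, K n) = 0 := by
    have key : ∀ n : ℕ, μ (s \ ⋃ n, K n) ≤ ((n : ℝ≥0∞) + 1)⁻¹ := by
      intro n
      have e := measure_inter_add_sdiff (μ := μ) s (h2 n).measurableSet
      rw [inter_eq_self_of_subset_right (h1 n)] at e
      have := h3 n
      rw [← e] at this
      refine (measure_mono (sdiff_subset_sdiff_right (subset_iUnion K n))).trans ?_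
      exact (ENNReal.add_le_add_iff_left (measure_ne_top _ _)).1 this
    refine le_antisymm (ge_of_tendsto' (x := atTop) (f := fun n : ℕ => ((n : ℝ≥0∞) + 1)⁻¹) ?_ key) zero_le
    have := (tendsto_add_atTop_iff_nat 1).2 ENNReal.tendsto_inv_nat_nhds_zero
    simpa using this
  have : s =ᵐ[μ] ⋃ n, K n := by
    refine EventuallyLE.antisymm ?_ (LE.le.eventuallyLE hsub)
    exact ae_le_set.2 hz
  exact ⟨_, hm, this⟩

/-- Points of `C` around which the vertical section of `C` is `ε`-dense at scales below `δ`. -/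
def ColD (C : Set (ℝ × ℝ)) (ε δ : ℝ) : Set (ℝ × ℝ) :=
  {p | p ∈ C ∧ ∀ t : ℝ, |t| < δ → ∃ y, |y - (p.2 + t)| ≤ ε * |t| ∧ (p.1, y) ∈ C}

/-- Same as `ColD`, for horizontal sections. -/
def RowD (C : Set (ℝ × ℝ)) (ε δ : ℝ) : Set (ℝ × ℝ) :=
  {p | p ∈ C ∧ ∀ t : ℝ, |t| < δ → ∃ x, |x - (p.1 + t)| ≤ ε * |t| ∧ (x, p.2) ∈ C}

theorem ColD_mono {C : Set (ℝ × ℝ)} {ε ε' δ δ' : ℝ} (h : ε ≤ ε') (h' : δ' ≤ δ) :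
    ColD C ε δ ⊆ ColD C ε' δ' := by
  rintro p ⟨h1, h2⟩
  refine ⟨h1, fun t ht => ?_⟩
  obtain ⟨y, hy, hy'⟩ := h2 t (ht.trans_le h')
  exact ⟨y, hy.trans (mul_le_mul_of_nonneg_right h (abs_nonneg t)), hy'⟩

theorem RowD_swap (C : Set (ℝ × ℝ)) (ε δ : ℝ) :
    RowD C ε δ = Prod.swap ⁻¹' (ColD (Prod.swap ⁻¹' C) ε δ) := rfl

theorem ColD_isClosed {C : Set (ℝ × ℝ)} (hC : IsCompact C) (ε δ : ℝ) :
    IsClosed (ColD C ε δ) := by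
  have : ColD C ε δ = C ∩ ⋂ t : ℝ, ⋂ _ : |t| < δ,
      Prod.fst '' ({z : (ℝ × ℝ) × (ℝ × ℝ) | |z.2.2 - (z.1.2 + t)| ≤ ε * |t| ∧ z.1.1 = z.2.1} ∩
        (univ ×ˢ C)) := by
    ext p
    simp only [ColD, mem_ofPred_eq, mem_inter_iff, mem_iInter, mem_image, mem_prod, mem_univ,
      true_and]
    refine and_congr_right fun hp => forall_congr' fun t => forall_congr' fun ht => ?_
    constructor
    · rintro ⟨y, h1, h2⟩
      exact ⟨(p, (p.1, y)), ⟨⟨h1, rfl⟩, h2⟩, rfl⟩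
    · rintro ⟨⟨a, b⟩, ⟨⟨h1, h2⟩, h3⟩, h4⟩
      simp only at h1 h2 h3 h4
      subst h4
      exact ⟨b.2, h1, by rw [h2]; exact h3⟩
  rw [this]
  refine hC.isClosed.inter (isClosed_iInter fun t => isClosed_iInter fun _ => ?_)
  have hK : IsClosed {z : (ℝ × ℝ) × (ℝ × ℝ) | |z.2.2 - (z.1.2 + t)| ≤ ε * |t| ∧ z.1.1 = z.2.1} := by
    apply IsClosed.inter
    · exact isClosed_le (f := fun z : (ℝ × ℝ) × (ℝ × ℝ) => |z.2.2 - (z.1.2 + t)|)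
        (g := fun _ => ε * |t|) (by fun_prop) (by fun_prop)
    · exact isClosed_eq (f := fun z : (ℝ × ℝ) × (ℝ × ℝ) => z.1.1)
        (g := fun z => z.2.1) (by fun_prop) (by fun_prop)
  have e : Prod.fst '' ({z : (ℝ × ℝ) × (ℝ × ℝ) | |z.2.2 - (z.1.2 + t)| ≤ ε * |t| ∧ z.1.1 = z.2.1} ∩
        (univ ×ˢ C)) = Prod.fst '' ({z : (ℝ × ℝ) × C |
          |z.2.1.2 - (z.1.2 + t)| ≤ ε * |t| ∧ z.1.1 = z.2.1.1}) := by
    ext p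
    constructor
    · rintro ⟨⟨a, b⟩, ⟨h, _, hb⟩, rfl⟩
      exact ⟨(a, ⟨b, hb⟩), h, rfl⟩
    · rintro ⟨⟨a, ⟨b, hb⟩⟩, h, rfl⟩
      exact ⟨(a, b), ⟨h, mem_univ _, hb⟩, rfl⟩
  rw [e]
  have : CompactSpace C := isCompact_iff_compactSpace.1 hC
  apply isClosedMap_fst_of_compactSpace
  exact hK.preimage (f := fun z : (ℝ × ℝ) × C => (z.1, z.2.1)) (by fun_prop)

theorem ColD_isCompact {C : Set (ℝ × ℝ)} (hC : IsCompact C) (ε δ : ℝ) :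
    IsCompact (ColD C ε δ) :=
  hC.of_isClosed_subset (ColD_isClosed hC ε δ) (fun _ h => h.1)

theorem swap_isCompact {C : Set (ℝ × ℝ)} (hC : IsCompact C) : IsCompact (Prod.swap ⁻¹' C) := by
  rw [← image_swap_eq_preimage_swap]
  exact hC.image continuous_swap

theorem RowD_isCompact {C : Set (ℝ × ℝ)} (hC : IsCompact C) (ε δ : ℝ) :
    IsCompact (RowD C ε δ) :=
  swap_isCompact (ColD_isCompact (swap_isCompact hC) ε δ)

theorem section_dense {S : Set ℝ} (hS : IsClosed S) :
    ∀ᵐ y : ℝ, y ∈ S → ∀ ε > 0, ∃ δ > 0, ∀ t : ℝ, |t| < δ →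
      ∃ z, |z - (y + t)| ≤ ε * |t| ∧ z ∈ S := by
  have hl : LipschitzWith 1 (fun y => Metric.infDist y S) := Metric.lipschitz_infDist_pt S
  filter_upwards [hl.ae_differentiableAt (μ := volume)] with y hy hyS ε hε
  have h0 : Metric.infDist y S = 0 := Metric.infDist_zero_of_mem hyS
  have hmin : IsLocalMin (fun y => Metric.infDist y S) y :=
    Eventually.of_forall fun z => by simp only [h0]; exact Metric.infDist_nonneg
  have hd := hy.hasDerivAt
  rw [hmin.deriv_eq_zero, hasDerivAt_iff_isLittleO_nhds_zero] at hd
  have := hd.bound hε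
  obtain ⟨δ, hδ, h⟩ := Metric.eventually_nhds_iff.1 this
  refine ⟨δ, hδ, fun t ht => ?_⟩
  have h1 := h (y := t) (by simpa using ht)
  obtain ⟨z, hz, hz'⟩ := hS.exists_infDist_eq_dist ⟨y, hyS⟩ (y + t)
  refine ⟨z, ?_, hz⟩
  simp only [h0, smul_zero, sub_zero, Real.norm_eq_abs] at h1
  rw [hz', abs_of_nonneg dist_nonneg, dist_comm, Real.dist_eq] at h1
  exact h1

theorem ae_ColD {C : Set (ℝ × ℝ)} (hC : IsCompact C) :
    ∀ᵐ p : ℝ × ℝ, p ∈ C → ∀ ε > 0, ∃ δ > 0, p ∈ ColD C ε δ := by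
  let Z : Set (ℝ × ℝ) := C \ ⋂ j : ℕ, ⋃ m : ℕ, ColD C (1 / ((j : ℝ) + 1)) (1 / ((m : ℝ) + 1))
  have hZ : MeasurableSet Z := hC.measurableSet.diff
    (MeasurableSet.iInter fun j => MeasurableSet.iUnion fun m => (ColD_isClosed hC _ _).measurableSet)
  have hZ0 : volume Z = 0 := by
    rw [Measure.volume_eq_prod, Measure.measure_prod_null hZ]
    refine Eventually.of_forall fun x => ?_
    have hS : IsClosed (Prod.mk x ⁻¹' C) := hC.isClosed.preimage (by fun_prop)
    have := section_dense hS
    rw [ae_iff] at this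
    refine measure_mono_null ?_ this
    rintro y ⟨hyC, hy⟩ hcon
    apply hy
    rw [mem_iInter]
    intro j
    obtain ⟨δ, hδ, h⟩ := hcon hyC (1 / ((j : ℝ) + 1)) (by positivity)
    obtain ⟨m, hm⟩ := exists_nat_one_div_lt hδ
    exact mem_iUnion.2 ⟨m, hyC, fun t ht => h t (ht.trans hm)⟩
  filter_upwards [compl_mem_ae_iff.2 hZ0] with p hp hpC ε hε
  obtain ⟨j, hj⟩ := exists_nat_one_div_lt hε
  have : p ∈ ⋂ j : ℕ, ⋃ m : ℕ, ColD C (1 / ((j : ℝ) + 1)) (1 / ((m : ℝ) + 1)) := by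
    by_contra h
    exact hp ⟨hpC, h⟩
  obtain ⟨m, hm⟩ := mem_iUnion.1 (mem_iInter.1 this j)
  exact ⟨1 / ((m : ℝ) + 1), by positivity, ColD_mono hj.le le_rfl hm⟩

theorem ae_swap {P : ℝ × ℝ → Prop} (h : ∀ᵐ p : ℝ × ℝ, P p) : ∀ᵐ p : ℝ × ℝ, P p.swap :=
  (Measure.measurePreserving_swap (μ := (volume : Measure ℝ)) (ν := (volume : Measure ℝ))
    ).quasiMeasurePreserving.ae h

theorem ae_RowD {C : Set (ℝ × ℝ)} (hC : IsCompact C) :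
    ∀ᵐ p : ℝ × ℝ, p ∈ C → ∀ ε > 0, ∃ δ > 0, p ∈ RowD C ε δ := by
  have h := ae_swap (ae_ColD (swap_isCompact hC))
  exact h

theorem diff_bound {U : ℝ × ℝ → ℝ} {C : Set (ℝ × ℝ)} {p : ℝ × ℝ}
    (hU : DifferentiableWithinAt ℝ U C p) :
    ∃ α a : ℝ, ∀ c > 0, ∃ ρ > 0, ∀ q ∈ C, |q.1 - p.1| < ρ → |q.2 - p.2| < ρ →
      |U q - U p - α * (q.1 - p.1) - a * (q.2 - p.2)| ≤ c * (|q.1 - p.1| + |q.2 - p.2|) := by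
  obtain ⟨L, hL⟩ := hU
  refine ⟨L (1, 0), L (0, 1), fun c hc => ?_⟩
  have := hL.isLittleO.bound hc
  rw [eventually_nhdsWithin_iff, Metric.eventually_nhds_iff] at this
  obtain ⟨ρ, hρ, h⟩ := this
  refine ⟨ρ, hρ, fun q hq h1 h2 => ?_⟩
  have hd : dist q p < ρ := by
    rw [Prod.dist_eq, Real.dist_eq, Real.dist_eq]
    exact max_lt h1 h2
  have h3 := h hd hq
  have e : L (q - p) = L (1, 0) * (q.1 - p.1) + L (0, 1) * (q.2 - p.2) := by
    have : q - p = (q.1 - p.1) • ((1 : ℝ), (0 : ℝ)) + (q.2 - p.2) • ((0 : ℝ), (1 : ℝ)) := by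
      ext <;> simp
    rw [this, map_add, map_smul, map_smul]
    simp only [smul_eq_mul]
    ring
  rw [e, Real.norm_eq_abs] at h3
  have h4 : ‖q - p‖ ≤ |q.1 - p.1| + |q.2 - p.2| := by
    rw [Prod.norm_def]
    exact max_le (by simp) (by simp)
  calc _ = |U q - U p - (L (1, 0) * (q.1 - p.1) + L (0, 1) * (q.2 - p.2))| := by
        congr 1; ring
    _ ≤ _ := h3.trans (mul_le_mul_of_nonneg_left h4 hc.le)

theorem half_lemma (f : ℝ → ℝ → ℝ) (U : ℝ × ℝ → ℝ) (C : Set (ℝ × ℝ)) (M r : ℝ) (p : ℝ × ℝ)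
    (hr : 0 < r) (hM : 0 ≤ M)
    (hLx : ∀ q ∈ C, ∀ t, |t| < r → |U (q.1 + t, q.2) - U q| ≤ M * |t|)
    (hLy : ∀ q ∈ C, ∀ t, |t| < r → |U (q.1, q.2 + t) - U q| ≤ M * |t|)
    (hU : DifferentiableWithinAt ℝ U C p)
    (hf : ∀ᶠ q in 𝓝 p, HasDerivAt (fun t => f t q.2) (U q) q.1)
    (hcol : ∀ ε > 0, ∃ δ > 0, p ∈ ColD C ε δ) :
    ∃ a, HasDerivAt (fun t => U (p.1, t)) a p.2 ∧ ∀ η > 0, ∃ ε > 0, ∀ δ > 0,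
      p ∈ RowD C ε δ → ∃ ρ > 0, ∀ h k : ℝ, 0 < h → h < ρ → |k| < ρ →
        (p.1, p.2 + k) ∈ RowD C ε δ →
        |f (p.1 + h) (p.2 + k) - f (p.1 + h) p.2 - f p.1 (p.2 + k) + f p.1 p.2 - a * h * k|
          ≤ η * h * (h + |k|) := by
  obtain ⟨α, a, hB⟩ := diff_bound hU
  refine ⟨a, ?_, ?_⟩
  · rw [hasDerivAt_iff_isLittleO_nhds_zero, Asymptotics.isLittleO_iff]
    intro η hη
    obtain ⟨ρ, hρ, hB⟩ := hB (η / 4) (by positivity)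
    have hD : 0 < 2 * (M + |a| + 1) := by positivity
    set ε := min 1 (η / (2 * (M + |a| + 1))) with hε
    have hε0 : 0 < ε := lt_min one_pos (by positivity)
    have hε1 : ε ≤ 1 := min_le_left _ _
    have hε2 : (M + |a|) * ε ≤ η / 2 := by
      have : ε ≤ η / (2 * (M + |a| + 1)) := min_le_right _ _
      rw [le_div_iff₀ hD] at this
      nlinarith
    obtain ⟨δ, hδ, -, hcol⟩ := hcol ε hε0
    have hmin : 0 < min δ (min (ρ / 2) r) := by positivity
    rw [Metric.eventually_nhds_iff]
    refine ⟨_, hmin, fun {t} ht => ?_⟩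
    rw [Real.dist_eq, sub_zero, lt_min_iff, lt_min_iff] at ht
    obtain ⟨ht1, ht2, ht3⟩ := ht
    obtain ⟨y, hy, hyC⟩ := hcol t ht1
    have hy1 : |y - (p.2 + t)| ≤ |t| := hy.trans (by nlinarith [abs_nonneg t])
    have hy2 : |y - p.2| ≤ 2 * |t| := by
      have : y - p.2 = (y - (p.2 + t)) + t := by ring
      rw [this]
      exact (abs_add_le _ _).trans (by linarith)
    have e1 := hLy _ hyC (p.2 + t - y) (by rw [abs_sub_comm]; linarith)
    have e2 := hB _ hyC (by simpa using hρ) (by simp only; linarith)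
    simp only [sub_self, mul_zero, abs_zero, zero_add, sub_zero, add_sub_cancel] at e1 e2
    rw [abs_sub_comm (p.2 + t) y] at e1
    simp only [Real.norm_eq_abs, smul_eq_mul]
    have e3 : U (p.1, p.2 + t) - U (p.1, p.2) - t * a
        = (U (p.1, p.2 + t) - U (p.1, y)) + (U (p.1, y) - U p - a * (y - p.2))
          + a * (y - (p.2 + t)) := by ring
    rw [e3]
    have e4 : |a * (y - (p.2 + t))| ≤ |a| * (ε * |t|) := by
      rw [abs_mul]; exact mul_le_mul_of_nonneg_left hy (abs_nonneg a)
    have e5 := mul_le_mul_of_nonneg_left hy hM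
    have e6 := mul_le_mul_of_nonneg_right hε2 (abs_nonneg t)
    have e7 := mul_le_mul_of_nonneg_left hy2 (show 0 ≤ η / 4 by positivity)
    refine (abs_add_three _ _ _).trans ?_
    nlinarith
  · intro η hη
    obtain ⟨ρ, hρ, hB⟩ := hB (η / 8) (by positivity)
    have hD : 0 < 4 * (M + |α| + 1) := by positivity
    set ε := min 1 (η / (4 * (M + |α| + 1))) with hε
    have hε0 : 0 < ε := lt_min one_pos (by positivity)
    have hε1 : ε ≤ 1 := min_le_left _ _
    have hε2 : (M + |α|) * ε ≤ η / 4 := by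
      have : ε ≤ η / (4 * (M + |α| + 1)) := min_le_right _ _
      rw [le_div_iff₀ hD] at this
      nlinarith
    refine ⟨ε, hε0, fun δ hδ hp => ?_⟩
    -- estimate on a good row
    have row : ∀ k s : ℝ, (p.1, p.2 + k) ∈ RowD C ε δ → |s| < δ → |s| < ρ / 2 → |s| < r → |k| < ρ →
        |U (p.1 + s, p.2 + k) - U p - α * s - a * k| ≤ η / 2 * (|s| + |k|) := by
      intro k s hk hs1 hs2 hs3 hkρ
      obtain ⟨x, hx, hxC⟩ := hk.2 s hs1
      simp only at hx hxC
      have hx1 : |x - (p.1 + s)| ≤ |s| := hx.trans (by nlinarith [abs_nonneg s])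
      have hx2 : |x - p.1| ≤ 2 * |s| := by
        have : x - p.1 = (x - (p.1 + s)) + s := by ring
        rw [this]
        exact (abs_add_le _ _).trans (by linarith)
      have e1 := hLx _ hxC (p.1 + s - x) (by rw [abs_sub_comm]; linarith)
      have e2 := hB _ hxC (by simp only; linarith) (by simpa using hkρ)
      simp only [add_sub_cancel, add_sub_cancel_left] at e1 e2
      rw [abs_sub_comm (p.1 + s) x] at e1
      have e3 : U (p.1 + s, p.2 + k) - U p - α * s - a * k
          = (U (p.1 + s, p.2 + k) - U (x, p.2 + k)) + (U (x, p.2 + k) - U p - α * (x - p.1) - a * k)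
            + α * (x - (p.1 + s)) := by ring
      rw [e3]
      have e4 : |α * (x - (p.1 + s))| ≤ |α| * (ε * |s|) := by
        rw [abs_mul]; exact mul_le_mul_of_nonneg_left hx (abs_nonneg α)
      have e5 := mul_le_mul_of_nonneg_left hx hM
      have e6 := mul_le_mul_of_nonneg_right hε2 (abs_nonneg s)
      have e7 := mul_le_mul_of_nonneg_left hx2 (show 0 ≤ η / 8 by positivity)
      have e8 : 0 ≤ η * |k| := by positivity
      refine (abs_add_three _ _ _).trans ?_
      nlinarith
    obtain ⟨ρ', hρ', hf⟩ := Metric.eventually_nhds_iff.1 hf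
    refine ⟨min (min δ ρ') (min (ρ / 2) r), by positivity, fun h k hh0 hh hk hkR => ?_⟩
    rw [lt_min_iff, lt_min_iff, lt_min_iff] at hh hk
    obtain ⟨⟨hh1, hh2⟩, hh3, hh4⟩ := hh
    obtain ⟨⟨hk1, hk2⟩, hk3, hk4⟩ := hk
    have hder : ∀ x ∈ Icc p.1 (p.1 + h), HasDerivAt (fun t => f t (p.2 + k) - f t p.2)
        (U (x, p.2 + k) - U (x, p.2)) x := by
      intro x hx
      have hx' : |x - p.1| < ρ' := by
        rw [abs_of_nonneg (by linarith [hx.1])]; linarith [hx.2]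
      have d1 := hf (y := (x, p.2 + k)) (by
        rw [Prod.dist_eq, Real.dist_eq, Real.dist_eq]
        exact max_lt hx' (by simpa using hk2))
      have d2 := hf (y := (x, p.2)) (by
        rw [Prod.dist_eq, Real.dist_eq, Real.dist_eq]
        exact max_lt hx' (by simpa using hρ'))
      exact d1.sub d2
    obtain ⟨ξ, hξ, hs⟩ := exists_hasDerivAt_eq_slope (fun t => f t (p.2 + k) - f t p.2)
      (fun x => U (x, p.2 + k) - U (x, p.2)) (show p.1 < p.1 + h by linarith)
      (fun x hx => (hder x hx).continuousAt.continuousWithinAt)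
      (fun x hx => hder x ⟨hx.1.le, hx.2.le⟩)
    obtain ⟨s, rfl⟩ : ∃ s, ξ = p.1 + s := ⟨ξ - p.1, by ring⟩
    have hs0 : 0 < s := by linarith [hξ.1]
    have hsh : s < h := by linarith [hξ.2]
    have hsa : |s| = s := abs_of_pos hs0
    have r1 := row k s hkR (by linarith) (by linarith) (by linarith) (by linarith)
    have r2 := row 0 s (by simpa using hp) (by linarith) (by linarith) (by linarith) (by simpa)
    simp only [add_zero, mul_zero, sub_zero, abs_zero] at r2
    rw [add_sub_cancel_left, eq_div_iff hh0.ne'] at hs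
    have e : f (p.1 + h) (p.2 + k) - f (p.1 + h) p.2 - f p.1 (p.2 + k) + f p.1 p.2 - a * h * k
        = h * ((U (p.1 + s, p.2 + k) - U p - α * s - a * k) - (U (p.1 + s, p.2) - U p - α * s)) := by
      linarith
    rw [e, abs_mul, abs_of_pos hh0]
    have r3 := (abs_sub (U (p.1 + s, p.2 + k) - U p - α * s - a * k)
      (U (p.1 + s, p.2) - U p - α * s)).trans (add_le_add r1 r2)
    rw [hsa] at r3
    have r4 : η / 2 * (s + |k|) + η / 2 * s ≤ η * (h + |k|) := by
      have : 0 ≤ η * |k| := by positivity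
      nlinarith
    calc _ ≤ h * (η * (h + |k|)) := mul_le_mul_of_nonneg_left (r3.trans r4) hh0.le
      _ = _ := by ring

theorem RowD_mono {C : Set (ℝ × ℝ)} {ε ε' δ δ' : ℝ} (h : ε ≤ ε') (h' : δ' ≤ δ) :
    RowD C ε δ ⊆ RowD C ε' δ' := by
  intro p hp
  have : p.swap ∈ ColD (Prod.swap ⁻¹' C) ε' δ' := ColD_mono (C := Prod.swap ⁻¹' C) h h' hp
  exact this

theorem lip_of_cross {U : ℝ × ℝ → ℝ} {C : Set (ℝ × ℝ)} {M r : ℝ} (hM : 0 ≤ M)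
    (hd : ∀ q ∈ C, ∀ q' ∈ C, |q.1 - q'.1| < r ∧ |q.2 - q'.2| < r)
    (hLx : ∀ q ∈ C, ∀ t, |t| < r → |U (q.1 + t, q.2) - U q| ≤ M * |t|)
    (hLy : ∀ q ∈ C, ∀ t, |t| < r → |U (q.1, q.2 + t) - U q| ≤ M * |t|) :
    ∀ᵐ p : ℝ × ℝ, p ∈ C → DifferentiableWithinAt ℝ U C p := by
  have : LipschitzOnWith (Real.toNNReal (2 * M)) U C := by
    apply LipschitzOnWith.of_dist_le_mul
    intro q hq q' hq'
    rw [Real.coe_toNNReal _ (by positivity)]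
    obtain ⟨h1, h2⟩ := hd q hq q' hq'
    have e1 := hLx q hq (q'.1 - q.1) (by rwa [abs_sub_comm])
    have e2 := hLy q' hq' (q.2 - q'.2) h2
    simp only [add_sub_cancel] at e1 e2
    have h3 : |q'.1 - q.1| ≤ dist q q' := by
      rw [abs_sub_comm, ← Real.dist_eq, Prod.dist_eq]; exact le_max_left _ _
    have h4 : |q.2 - q'.2| ≤ dist q q' := by
      rw [← Real.dist_eq, Prod.dist_eq]; exact le_max_right _ _
    rw [Real.dist_eq]
    have e3 : U q - U q' = (U (q'.1, q.2) - U q') - (U (q'.1, q.2) - U q) := by ring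
    rw [e3]
    refine (abs_sub _ _).trans ?_
    nlinarith
  exact this.ae_differentiableWithinAt_of_mem

theorem compact_case (f : ℝ → ℝ → ℝ) (U V : ℝ × ℝ → ℝ) (C : Set (ℝ × ℝ)) (M r : ℝ)
    (hC : IsCompact C) (hr : 0 < r) (hM : 0 ≤ M)
    (hd : ∀ q ∈ C, ∀ q' ∈ C, |q.1 - q'.1| < r ∧ |q.2 - q'.2| < r)
    (hUx : ∀ q ∈ C, ∀ t, |t| < r → |U (q.1 + t, q.2) - U q| ≤ M * |t|)
    (hUy : ∀ q ∈ C, ∀ t, |t| < r → |U (q.1, q.2 + t) - U q| ≤ M * |t|)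
    (hVx : ∀ q ∈ C, ∀ t, |t| < r → |V (q.1 + t, q.2) - V q| ≤ M * |t|)
    (hVy : ∀ q ∈ C, ∀ t, |t| < r → |V (q.1, q.2 + t) - V q| ≤ M * |t|)
    (hf : ∀ q ∈ C, ∀ᶠ q' in 𝓝 q, HasDerivAt (fun t => f t q'.2) (U q') q'.1)
    (hf' : ∀ q ∈ C, ∀ᶠ q' in 𝓝 q, HasDerivAt (fun t => f q'.1 t) (V q') q'.2) :
    ∀ᵐ p : ℝ × ℝ, p ∈ C → ∃ d, HasDerivAt (fun t => U (p.1, t)) d p.2 ∧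
      HasDerivAt (fun t => V (t, p.2)) d p.1 := by
  have c1 : ∀ᵐ p : ℝ × ℝ, ∀ j m : ℕ, p ∈ RowD C (1 / ((j : ℝ) + 1)) (1 / ((m : ℝ) + 1)) →
      ∀ ε > 0, ∃ δ > 0, p ∈ ColD (RowD C (1 / ((j : ℝ) + 1)) (1 / ((m : ℝ) + 1))) ε δ :=
    ae_all_iff.2 fun j => ae_all_iff.2 fun m => ae_ColD (RowD_isCompact hC _ _)
  have c2 : ∀ᵐ p : ℝ × ℝ, ∀ j m : ℕ, p ∈ ColD C (1 / ((j : ℝ) + 1)) (1 / ((m : ℝ) + 1)) →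
      ∀ ε > 0, ∃ δ > 0, p ∈ RowD (ColD C (1 / ((j : ℝ) + 1)) (1 / ((m : ℝ) + 1))) ε δ :=
    ae_all_iff.2 fun j => ae_all_iff.2 fun m => ae_RowD (ColD_isCompact hC _ _)
  filter_upwards [lip_of_cross hM hd hUx hUy, lip_of_cross hM hd hVx hVy, ae_ColD hC, ae_RowD hC,
    c1, c2] with p h1 h2 h3 h4 h5 h6 hp
  obtain ⟨a, ha, hA⟩ := half_lemma f U C M r p hr hM hUx hUy (h1 hp) (hf p hp) (h3 hp)
  have hdV : DifferentiableWithinAt ℝ (V ∘ Prod.swap) (Prod.swap ⁻¹' C) p.swap := by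
    have : DifferentiableWithinAt ℝ V C (Prod.swap p.swap) := by simpa using h2 hp
    refine this.comp (t := C) p.swap ?_ (fun q hq => hq)
    exact (differentiable_snd.prodMk differentiable_fst).differentiableAt.differentiableWithinAt
  have hfs : ∀ᶠ q in 𝓝 p.swap,
      HasDerivAt (fun t => (fun y x => f x y) t q.2) ((V ∘ Prod.swap) q) q.1 :=
    (continuous_swap.tendsto' p.swap p (by simp)).eventually (hf' p hp)
  obtain ⟨b, hb, hB⟩ := half_lemma (fun y x => f x y) (V ∘ Prod.swap) (Prod.swap ⁻¹' C) M r
    p.swap hr hM (fun q hq t ht => hVy q.swap hq t ht) (fun q hq t ht => hVx q.swap hq t ht)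
    hdV hfs (h4 hp)
  suffices a = b by
    subst this
    exact ⟨a, ha, hb⟩
  have key : ∀ η > 0, |a - b| ≤ 8 * η := by
    intro η hη
    obtain ⟨ε1, hε1, hA⟩ := hA η hη
    obtain ⟨ε2, hε2, hB⟩ := hB η hη
    obtain ⟨j, hj⟩ := exists_nat_one_div_lt (lt_min hε1 hε2)
    rw [lt_min_iff] at hj
    obtain ⟨δa, hδa, hpa⟩ := h4 hp (1 / ((j : ℝ) + 1)) (by positivity)
    obtain ⟨δb, hδb, hpb⟩ := h3 hp (1 / ((j : ℝ) + 1)) (by positivity)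
    obtain ⟨m, hm⟩ := exists_nat_one_div_lt (lt_min hδa hδb)
    rw [lt_min_iff] at hm
    replace hpa := RowD_mono le_rfl hm.1.le hpa
    replace hpb := ColD_mono le_rfl hm.2.le hpb
    obtain ⟨δ1, hδ1, -, g1⟩ := h5 j m hpa (1 / 2) (by norm_num)
    obtain ⟨δ2, hδ2, -, g2⟩ := h6 j m hpb (1 / 2) (by norm_num)
    obtain ⟨ρ1, hρ1, hA⟩ := hA (1 / ((m : ℝ) + 1)) (by positivity) (RowD_mono hj.1.le le_rfl hpa)
    obtain ⟨ρ2, hρ2, hB⟩ := hB (1 / ((m : ℝ) + 1)) (by positivity)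
      (ColD_mono hj.2.le le_rfl hpb)
    obtain ⟨h, hh0, hh⟩ : ∃ h, 0 < h ∧ h < min (min δ1 δ2) (min (ρ1 / 2) (ρ2 / 2)) :=
      exists_between (by positivity)
    rw [lt_min_iff, lt_min_iff, lt_min_iff] at hh
    obtain ⟨⟨q1, q2⟩, q3, q4⟩ := hh
    have hha : |h| = h := abs_of_pos hh0
    obtain ⟨y, hy, hyR⟩ := g1 h (by rwa [hha])
    obtain ⟨x, hx, hxR⟩ := g2 h (by rwa [hha])
    obtain ⟨k, rfl⟩ : ∃ k, y = p.2 + k := ⟨y - p.2, by ring⟩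
    obtain ⟨l, rfl⟩ : ∃ l, x = p.1 + l := ⟨x - p.1, by ring⟩
    rw [hha, abs_le] at hx hy
    have k1 : h / 2 ≤ k := by linarith [hy.1]
    have k2 : k ≤ 3 * h / 2 := by linarith [hy.2]
    have l1 : h / 2 ≤ l := by linarith [hx.1]
    have l2 : l ≤ 3 * h / 2 := by linarith [hx.2]
    have hk0 : 0 < k := by linarith
    have hl0 : 0 < l := by linarith
    have hka : |k| = k := abs_of_pos hk0
    have hla : |l| = l := abs_of_pos hl0
    have A := hA l k hl0 (by linarith) (by linarith) (RowD_mono hj.1.le le_rfl hyR)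
    have B := hB k l hk0 (by linarith) (by linarith) (ColD_mono hj.2.le le_rfl hxR)
    simp only [Prod.fst_swap, Prod.snd_swap] at B
    rw [hka] at A
    rw [hla] at B
    rw [abs_le] at A B
    have hlk : 0 < l * k := by positivity
    have hq : (l + k) ^ 2 ≤ 8 * (l * k) := by nlinarith
    have : |(a - b) * (l * k)| ≤ 8 * η * (l * k) := by
      rw [abs_le]
      constructor <;> nlinarith [A.1, A.2, B.1, B.2]
    rw [abs_mul, abs_of_pos hlk] at this
    exact le_of_mul_le_mul_right this hlk
  have : |a - b| ≤ 0 := by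
    apply le_of_forall_pos_le_add
    intro η hη
    have := key (η / 8) (by positivity)
    linarith
  exact sub_eq_zero.1 (abs_nonpos_iff.1 this)

def LX (U : ℝ × ℝ → ℝ) (M r : ℝ) : Set (ℝ × ℝ) :=
  {p | ∀ t, |t| < r → |U (p.1 + t, p.2) - U p| ≤ M * |t|}

def LY (U : ℝ × ℝ → ℝ) (M r : ℝ) : Set (ℝ × ℝ) :=
  {p | ∀ t, |t| < r → |U (p.1, p.2 + t) - U p| ≤ M * |t|}

theorem LX_null {U : ℝ × ℝ → ℝ} (hU : Measurable U) (M r : ℝ) (μ : Measure (ℝ × ℝ))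
    [IsFiniteMeasure μ] : NullMeasurableSet (LX U M r) μ := by
  have hs : MeasurableSet {z : (ℝ × ℝ) × ℝ | |z.2| < r ∧
      M * |z.2| < |U (z.1.1 + z.2, z.1.2) - U z.1|} := by
    apply MeasurableSet.inter
    · exact measurableSet_lt (f := fun z : (ℝ × ℝ) × ℝ => |z.2|) (by fun_prop) (by fun_prop)
    · exact measurableSet_lt (f := fun z : (ℝ × ℝ) × ℝ => M * |z.2|)
        (g := fun z => |U (z.1.1 + z.2, z.1.2) - U z.1|) (by fun_prop) (by fun_prop)
  have := analytic_nullMeasurable μ (hs.analyticSet.image_of_continuous continuous_fst)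
  refine NullMeasurableSet.of_compl ?_
  convert this using 1
  ext p
  simp [LX]

theorem LY_null {U : ℝ × ℝ → ℝ} (hU : Measurable U) (M r : ℝ) (μ : Measure (ℝ × ℝ))
    [IsFiniteMeasure μ] : NullMeasurableSet (LY U M r) μ := by
  have hs : MeasurableSet {z : (ℝ × ℝ) × ℝ | |z.2| < r ∧
      M * |z.2| < |U (z.1.1, z.1.2 + z.2) - U z.1|} := by
    apply MeasurableSet.inter
    · exact measurableSet_lt (f := fun z : (ℝ × ℝ) × ℝ => |z.2|) (by fun_prop) (by fun_prop)
    · exact measurableSet_lt (f := fun z : (ℝ × ℝ) × ℝ => M * |z.2|)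
        (g := fun z => |U (z.1.1, z.1.2 + z.2) - U z.1|) (by fun_prop) (by fun_prop)
  have := analytic_nullMeasurable μ (hs.analyticSet.image_of_continuous continuous_fst)
  refine NullMeasurableSet.of_compl ?_
  convert this using 1
  ext p
  simp [LY]

/-- The open unit square. -/
def Sq : Set (ℝ × ℝ) := Ioo (0:ℝ) 1 ×ˢ Ioo (0:ℝ) 1

theorem Sq_open : IsOpen Sq := isOpen_Ioo.prod isOpen_Ioo

theorem Sq_finite : volume Sq ≠ ⊤ := by
  rw [Sq, Measure.volume_eq_prod, Measure.prod_prod]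
  simp

def KK (U V : ℝ × ℝ → ℝ) (n : ℕ) : Set (ℝ × ℝ) :=
  (LX U n (1 / ((n : ℝ) + 1)) ∩ LY U n (1 / ((n : ℝ) + 1)) ∩ LX V n (1 / ((n : ℝ) + 1)) ∩
    LY V n (1 / ((n : ℝ) + 1))) ∩ Sq

theorem KK_null {U V : ℝ × ℝ → ℝ} (hU : Measurable U) (hV : Measurable V) (n : ℕ) :
    NullMeasurableSet (KK U V n) volume := by
  have : Fact (volume Sq < ⊤) := ⟨Sq_finite.lt_top⟩
  have h : NullMeasurableSet (LX U n (1 / ((n : ℝ) + 1)) ∩ LY U n (1 / ((n : ℝ) + 1)) ∩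
      LX V n (1 / ((n : ℝ) + 1)) ∩ LY V n (1 / ((n : ℝ) + 1))) (volume.restrict Sq) :=
    (((LX_null hU _ _ _).inter (LY_null hU _ _ _)).inter (LX_null hV _ _ _)).inter
      (LY_null hV _ _ _)
  exact (nullMeasurableSet_restrict Sq_open.measurableSet.nullMeasurableSet).1 h

theorem core (f : ℝ → ℝ → ℝ) (U V : ℝ × ℝ → ℝ) (hU : Measurable U) (hV : Measurable V)
    (hf : ∀ q ∈ Sq, HasDerivAt (fun t => f t q.2) (U q) q.1)
    (hf' : ∀ q ∈ Sq, HasDerivAt (fun t => f q.1 t) (V q) q.2) (n : ℕ) :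
    ∀ᵐ p : ℝ × ℝ, p ∈ KK U V n → ∃ d, HasDerivAt (fun t => U (p.1, t)) d p.2 ∧
      HasDerivAt (fun t => V (t, p.2)) d p.1 := by
  set r : ℝ := 1 / ((n : ℝ) + 1) with hr
  have hr0 : 0 < r := by positivity
  have loc : ∀ i : ℕ, ∀ᵐ p : ℝ × ℝ,
      p ∈ KK U V n ∩ Metric.ball (TopologicalSpace.denseSeq (ℝ × ℝ) i) (r / 2) →
      ∃ d, HasDerivAt (fun t => U (p.1, t)) d p.2 ∧ HasDerivAt (fun t => V (t, p.2)) d p.1 := by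
    intro i
    set A := KK U V n ∩ Metric.ball (TopologicalSpace.denseSeq (ℝ × ℝ) i) (r / 2) with hA
    have hAn : NullMeasurableSet A volume :=
      (KK_null hU hV n).inter Metric.isOpen_ball.measurableSet.nullMeasurableSet
    obtain ⟨A', hA'A, hA'm, hA'e⟩ := hAn.exists_measurable_subset_ae_eq
    have hA'Sq : A' ⊆ Sq := fun q hq => (hA'A hq).1.2
    set G : Set (ℝ × ℝ) := {p | ∃ d, HasDerivAt (fun t => U (p.1, t)) d p.2 ∧
      HasDerivAt (fun t => V (t, p.2)) d p.1} with hG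
    have h0 : volume (A' \ G) = 0 := by
      by_contra hne
      have hfin : volume A' ≠ ⊤ := ne_top_of_le_ne_top Sq_finite (measure_mono hA'Sq)
      obtain ⟨C, hCA, hC, hlt⟩ := hA'm.exists_isCompact_sdiff_lt hfin hne
      have hCK : ∀ q ∈ C, q ∈ KK U V n := fun q hq => (hA'A (hCA hq)).1
      have hCG := compact_case f U V C n r hC hr0 (by positivity) (by
          intro q hq q' hq'
          have b1 := (hA'A (hCA hq)).2
          have b2 := (hA'A (hCA hq')).2
          have : dist q q' < r := by
            have := dist_triangle_right q q' (TopologicalSpace.denseSeq (ℝ × ℝ) i)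
            rw [Metric.mem_ball] at b1 b2
            linarith
          rw [Prod.dist_eq, max_lt_iff, Real.dist_eq, Real.dist_eq] at this
          exact this)
        (fun q hq => (hCK q hq).1.1.1.1) (fun q hq => (hCK q hq).1.1.1.2)
        (fun q hq => (hCK q hq).1.1.2) (fun q hq => (hCK q hq).1.2)
        (fun q hq => (Sq_open.eventually_mem (hCK q hq).2).mono fun q' h => hf q' h)
        (fun q hq => (Sq_open.eventually_mem (hCK q hq).2).mono fun q' h => hf' q' h)
      have hCG0 : volume (C \ G) = 0 := by
        rw [ae_iff] at hCG
        refine measure_mono_null ?_ hCG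
        rintro q ⟨h1, h2⟩ h3
        exact h2 (h3 h1)
      have : volume (A' \ G) ≤ volume (C \ G) + volume (A' \ C) := by
        refine (measure_mono ?_).trans (measure_union_le _ _)
        rintro q ⟨h1, h2⟩
        by_cases hq : q ∈ C
        · exact Or.inl ⟨hq, h2⟩
        · exact Or.inr ⟨h1, hq⟩
      rw [hCG0, zero_add] at this
      exact absurd hlt (not_lt.2 this)
    filter_upwards [compl_mem_ae_iff.2 h0, hA'e.mem_iff] with p hp hpe hpA
    by_contra hcon
    exact hp ⟨hpe.2 hpA, hcon⟩
  filter_upwards [ae_all_iff.2 loc] with p hp hpK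
  obtain ⟨i, hi⟩ := (TopologicalSpace.denseRange_denseSeq (ℝ × ℝ)).exists_dist_lt p
    (half_pos hr0)
  exact hp i ⟨hpK, hi⟩

theorem dini_side {l : Filter ℝ} {F : ℝ → ℝ}
    (h1 : limsup (fun t => ((F t : ℝ) : EReal)) l < ⊤)
    (h2 : ⊥ < liminf (fun t => ((F t : ℝ) : EReal)) l) :
    ∃ M : ℝ, ∀ᶠ t in l, |F t| ≤ M := by
  obtain ⟨a, ha, -⟩ := EReal.lt_iff_exists_real_btwn.1 h1
  obtain ⟨b, -, hb⟩ := EReal.lt_iff_exists_real_btwn.1 h2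
  refine ⟨max |a| |b|, ?_⟩
  filter_upwards [eventually_lt_of_limsup_lt ha, eventually_lt_of_lt_liminf hb] with t ht1 ht2
  have e1 : F t < a := EReal.coe_lt_coe_iff.1 ht1
  have e2 : b < F t := EReal.coe_lt_coe_iff.1 ht2
  rw [abs_le]
  constructor
  · have := neg_abs_le b
    have := le_max_right |a| |b|
    linarith
  · have := le_abs_self a
    have := le_max_left |a| |b|
    linarith

theorem dini_bound {g : ℝ → ℝ} {s : ℝ} (hs : s ∈ Ioo (0:ℝ) 1) (h : DiniFinite g s) :
    ∃ N : ℕ, ∀ n ≥ N, ∀ t : ℝ, |t| < 1 / ((n : ℝ) + 1) →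
      s + t ∈ Ioo (0:ℝ) 1 ∧ |g (s + t) - g s| ≤ n * |t| := by
  obtain ⟨h1, h2, h3, h4⟩ := h
  obtain ⟨M1, hM1⟩ := dini_side h1 h2
  obtain ⟨M2, hM2⟩ := dini_side h3 h4
  rw [eventually_nhdsWithin_iff, Metric.eventually_nhds_iff] at hM1 hM2
  obtain ⟨r1, hr1, hM1⟩ := hM1
  obtain ⟨r2, hr2, hM2⟩ := hM2
  have hpos : 0 < min (min r1 r2) (min s (1 - s)) := by
    have := hs.1
    have : 0 < 1 - s := by linarith [hs.2]
    positivity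
  obtain ⟨m, hm⟩ := exists_nat_one_div_lt hpos
  obtain ⟨k, hk⟩ := exists_nat_ge (max M1 M2)
  refine ⟨max m k, fun n hn t ht => ?_⟩
  have hnm : m ≤ n := (le_max_left _ _).trans hn
  have hnk : (k : ℝ) ≤ n := by exact_mod_cast (le_max_right _ _).trans hn
  have ht' : |t| < min (min r1 r2) (min s (1 - s)) :=
    ht.trans_le ((one_div_le_one_div_of_le (by positivity) (by
      have : (m : ℝ) ≤ n := by exact_mod_cast hnm
      linarith)).trans hm.le)
  rw [lt_min_iff, lt_min_iff, lt_min_iff] at ht'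
  obtain ⟨⟨t1, t2⟩, t3, t4⟩ := ht'
  have hI : s + t ∈ Ioo (0:ℝ) 1 := ⟨by linarith [neg_abs_le t], by linarith [le_abs_self t]⟩
  refine ⟨hI, ?_⟩
  have hM1k : M1 ≤ n := (le_max_left _ _).trans (hk.trans hnk)
  have hM2k : M2 ≤ n := (le_max_right _ _).trans (hk.trans hnk)
  rcases lt_trichotomy t 0 with h0 | h0 | h0
  · have := hM2 (y := t) (by simpa using t2) ⟨h0, Ioo_subset_Icc_self hI⟩
    rw [abs_div, div_le_iff₀ (abs_pos.2 h0.ne)] at this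
    exact this.trans (mul_le_mul_of_nonneg_right hM2k (abs_nonneg t))
  · simp [h0]
  · have := hM1 (y := t) (by simpa using t1) ⟨h0, Ioo_subset_Icc_self hI⟩
    rw [abs_div, div_le_iff₀ (abs_pos.2 h0.ne')] at this
    exact this.trans (mul_le_mul_of_nonneg_right hM1k (abs_nonneg t))

theorem tendsto_quot {g : ℝ → ℝ} {g' x : ℝ} (h : HasDerivAt g g' x) :
    Tendsto (fun n : ℕ => ((n : ℝ) + 1) * (g (x + 1 / ((n : ℝ) + 1)) - g x)) atTop (𝓝 g') := by
  have h1 := hasDerivAt_iff_tendsto_slope_zero.1 h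
  have h2 : Tendsto (fun n : ℕ => 1 / ((n : ℝ) + 1)) atTop (𝓝[≠] 0) :=
    tendsto_nhdsWithin_iff.2 ⟨tendsto_one_div_add_atTop_nhds_zero_nat,
      Eventually.of_forall fun n => by
        have : (0:ℝ) < 1 / ((n : ℝ) + 1) := by positivity
        exact this.ne'⟩
  refine (h1.comp h2).congr fun n => ?_
  simp

theorem meas_fst {F g : ℝ × ℝ → ℝ} (hF : Measurable F)
    (h : ∀ q ∈ Sq, HasDerivAt (fun t => F (t, q.2)) (g q) q.1) : Measurable (Sq.indicator g) := by
  refine measurable_of_tendsto_metrizable (f := fun n : ℕ => Sq.indicator fun q : ℝ × ℝ =>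
    ((n : ℝ) + 1) * (F (q.1 + 1 / ((n : ℝ) + 1), q.2) - F q)) (fun n => ?_) ?_
  · exact Measurable.indicator (by fun_prop) Sq_open.measurableSet
  · rw [tendsto_pi_nhds]
    intro q
    by_cases hq : q ∈ Sq
    · simp only [indicator_of_mem hq]
      exact tendsto_quot (h q hq)
    · simp only [indicator_of_notMem hq]
      exact tendsto_const_nhds

theorem meas_snd {F g : ℝ × ℝ → ℝ} (hF : Measurable F)
    (h : ∀ q ∈ Sq, HasDerivAt (fun t => F (q.1, t)) (g q) q.2) : Measurable (Sq.indicator g) := by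
  refine measurable_of_tendsto_metrizable (f := fun n : ℕ => Sq.indicator fun q : ℝ × ℝ =>
    ((n : ℝ) + 1) * (F (q.1, q.2 + 1 / ((n : ℝ) + 1)) - F q)) (fun n => ?_) ?_
  · exact Measurable.indicator (by fun_prop) Sq_open.measurableSet
  · rw [tendsto_pi_nhds]
    intro q
    by_cases hq : q ∈ Sq
    · simp only [indicator_of_mem hq]
      exact tendsto_quot (h q hq)
    · simp only [indicator_of_notMem hq]
      exact tendsto_const_nhds

theorem exists_meas_ext (f fx fy : ℝ → ℝ → ℝ)
    (hfx : ∀ x ∈ Icc (0:ℝ) 1, ∀ y ∈ Icc (0:ℝ) 1,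
      HasDerivWithinAt (fun t => f t y) (fx x y) (Icc (0:ℝ) 1) x)
    (hfy : ∀ x ∈ Icc (0:ℝ) 1, ∀ y ∈ Icc (0:ℝ) 1,
      HasDerivWithinAt (fun t => f x t) (fy x y) (Icc (0:ℝ) 1) y) :
    ∃ F : ℝ × ℝ → ℝ, Measurable F ∧
      ∀ x ∈ Icc (0:ℝ) 1, ∀ y ∈ Icc (0:ℝ) 1, F (x, y) = f x y := by
  let P : ℝ → ℝ := fun x => (projIcc (0:ℝ) 1 zero_le_one x : ℝ)
  have hP : ∀ x, P x ∈ Icc (0:ℝ) 1 := fun x => (projIcc (0:ℝ) 1 zero_le_one x).2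
  have hPc : Continuous P := continuous_subtype_val.comp continuous_projIcc
  refine ⟨Function.uncurry fun x y => f (P x) (P y), ?_, ?_⟩
  · apply measurable_uncurry_of_continuous_of_measurable
    · intro y
      have : ContinuousOn (fun t => f t (P y)) (Icc (0:ℝ) 1) :=
        fun x hx => (hfx x hx _ (hP y)).continuousWithinAt
      exact this.comp_continuous hPc hP
    · intro x
      have : ContinuousOn (fun t => f (P x) t) (Icc (0:ℝ) 1) :=
        fun y hy => (hfy _ (hP x) y hy).continuousWithinAt
      exact (this.comp_continuous hPc hP).measurable
  · intro x hx y hy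
    simp [P, projIcc_of_mem zero_le_one hx, projIcc_of_mem zero_le_one hy]

theorem Sq_ae : (Icc (0:ℝ) 1 ×ˢ Icc (0:ℝ) 1 : Set (ℝ × ℝ)) ≤ᵐ[volume] Sq :=
  (Measure.set_prod_ae_eq (μ := (volume : Measure ℝ)) (ν := (volume : Measure ℝ))
    Ioo_ae_eq_Icc.symm Ioo_ae_eq_Icc.symm).le

/-- If `f` has first partial derivatives `fx`, `fy` everywhere on `[0,1]²`, and
`E ⊆ [0,1]²` has positive measure and at every point of `E` all four Dini derivative numbers
of `fx` and `fy` with respect to each variable are finite, then at almost every point of `E`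
the mixed second partial derivatives exist and are equal. -/
theorem stmt1 (f fx fy : ℝ → ℝ → ℝ)
    (hfx : ∀ x ∈ Icc (0:ℝ) 1, ∀ y ∈ Icc (0:ℝ) 1,
      HasDerivWithinAt (fun t => f t y) (fx x y) (Icc (0:ℝ) 1) x)
    (hfy : ∀ x ∈ Icc (0:ℝ) 1, ∀ y ∈ Icc (0:ℝ) 1,
      HasDerivWithinAt (fun t => f x t) (fy x y) (Icc (0:ℝ) 1) y)
    (E : Set (ℝ × ℝ)) (hE : E ⊆ Icc (0:ℝ) 1 ×ˢ Icc (0:ℝ) 1) (hEpos : 0 < volume E)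
    (hdini : ∀ p ∈ E,
      DiniFinite (fun t => fx t p.2) p.1 ∧ DiniFinite (fun t => fx p.1 t) p.2 ∧
      DiniFinite (fun t => fy t p.2) p.1 ∧ DiniFinite (fun t => fy p.1 t) p.2) :
    ∀ᵐ p ∂(volume.restrict E), ∃ d : ℝ,
      HasDerivWithinAt (fun t => fx p.1 t) d (Icc (0:ℝ) 1) p.2 ∧
      HasDerivWithinAt (fun t => fy t p.2) d (Icc (0:ℝ) 1) p.1 := by
  obtain ⟨F, hFm, hF⟩ := exists_meas_ext f fx fy hfx hfy
  have hI : ∀ x ∈ Ioo (0:ℝ) 1, Icc (0:ℝ) 1 ∈ 𝓝 x := fun x hx => Icc_mem_nhds hx.1 hx.2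
  have hS : ∀ x ∈ Ioo (0:ℝ) 1, x ∈ Icc (0:ℝ) 1 := fun x hx => Ioo_subset_Icc_self hx
  have dx : ∀ q ∈ Sq, HasDerivAt (fun t => f t q.2) (fx q.1 q.2) q.1 := fun q hq =>
    (hfx q.1 (hS _ hq.1) q.2 (hS _ hq.2)).hasDerivAt (hI _ hq.1)
  have dy : ∀ q ∈ Sq, HasDerivAt (fun t => f q.1 t) (fy q.1 q.2) q.2 := fun q hq =>
    (hfy q.1 (hS _ hq.1) q.2 (hS _ hq.2)).hasDerivAt (hI _ hq.2)
  set U : ℝ × ℝ → ℝ := Sq.indicator fun q => fx q.1 q.2 with hUdef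
  set V : ℝ × ℝ → ℝ := Sq.indicator fun q => fy q.1 q.2 with hVdef
  have hUm : Measurable U := meas_fst hFm fun q hq =>
    (dx q hq).congr_of_eventuallyEq (by
      filter_upwards [hI _ hq.1] with t ht
      exact hF t ht q.2 (hS _ hq.2))
  have hVm : Measurable V := meas_snd hFm fun q hq =>
    (dy q hq).congr_of_eventuallyEq (by
      filter_upwards [hI _ hq.2] with t ht
      exact hF q.1 (hS _ hq.1) t ht)
  have hUe : ∀ q ∈ Sq, U q = fx q.1 q.2 := fun q hq => indicator_of_mem hq _
  have hVe : ∀ q ∈ Sq, V q = fy q.1 q.2 := fun q hq => indicator_of_mem hq _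
  have hcore := ae_all_iff.2 (core f U V hUm hVm
    (fun q hq => by rw [hUe q hq]; exact dx q hq) (fun q hq => by rw [hVe q hq]; exact dy q hq))
  have hDn : NullMeasurableSet (⋃ n, KK U V n) volume :=
    NullMeasurableSet.iUnion fun n => KK_null hUm hVm n
  have hED : E ≤ᵐ[volume] (⋃ n, KK U V n : Set (ℝ × ℝ)) := by
    filter_upwards [Sq_ae] with p hp hpE
    have hpS : p ∈ Sq := hp (hE hpE)
    obtain ⟨g1, g2, g3, g4⟩ := hdini p hpE
    obtain ⟨N1, b1⟩ := dini_bound hpS.1 g1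
    obtain ⟨N2, b2⟩ := dini_bound hpS.2 g2
    obtain ⟨N3, b3⟩ := dini_bound hpS.1 g3
    obtain ⟨N4, b4⟩ := dini_bound hpS.2 g4
    refine mem_iUnion.2 ⟨max (max N1 N2) (max N3 N4), ⟨⟨⟨?_, ?_⟩, ?_⟩, ?_⟩, hpS⟩
    · intro t ht
      obtain ⟨c1, c2⟩ := b1 _ (by simp) t ht
      rw [hUe (p.1 + t, p.2) ⟨c1, hpS.2⟩, hUe _ hpS]
      exact c2
    · intro t ht
      obtain ⟨c1, c2⟩ := b2 _ (by simp) t ht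
      rw [hUe (p.1, p.2 + t) ⟨hpS.1, c1⟩, hUe _ hpS]
      exact c2
    · intro t ht
      obtain ⟨c1, c2⟩ := b3 _ (by simp) t ht
      rw [hVe (p.1 + t, p.2) ⟨c1, hpS.2⟩, hVe _ hpS]
      exact c2
    · intro t ht
      obtain ⟨c1, c2⟩ := b4 _ (by simp) t ht
      rw [hVe (p.1, p.2 + t) ⟨hpS.1, c1⟩, hVe _ hpS]
      exact c2
  refine Eventually.filter_mono (ae_mono (Measure.restrict_mono_ae hED)) ?_
  rw [ae_restrict_iff'₀ hDn]
  filter_upwards [hcore] with p hp hpD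
  obtain ⟨n, hn⟩ := mem_iUnion.1 hpD
  obtain ⟨d, d1, d2⟩ := hp n hn
  have hpS : p ∈ Sq := hn.2
  refine ⟨d, (d1.congr_of_eventuallyEq ?_).hasDerivWithinAt,
    (d2.congr_of_eventuallyEq ?_).hasDerivWithinAt⟩
  · filter_upwards [Ioo_mem_nhds hpS.2.1 hpS.2.2] with t ht
    exact (hUe (p.1, t) ⟨hpS.1, ht⟩).symm
  · filter_upwards [Ioo_mem_nhds hpS.1.1 hpS.1.2] with t ht
    exact (hVe (t, p.2) ⟨ht, hpS.2⟩).symm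
end

section
/- Let h : [0,1]² → ℝ be Lebesgue integrable and define f(x,y) = ∫₀ˣ (∫₀ʸ h(u,v) dv) du. Then for almost every (x,y) ∈ [0,1]² (with respect to two-dimensional Lebesgue measure) the mixed second partial derivatives f''_{xy}(x,y) and f''_{yx}(x,y) exist and both equal h(x,y). -/
open MeasureTheory Set

open Filter Topology in
lemma aux_inner_integrable {H : ℝ × ℝ → ℝ} (hH : Integrable H) (t : ℝ) :
    Integrable (fun u => ∫ v in (0:ℝ)..t, H (u, v)) := by
  have h1 : ∀ s : Set ℝ, Integrable (fun u => ∫ v in s, H (u, v)) := by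
    intro s
    have h2 : Integrable H ((volume : Measure ℝ).prod (volume.restrict s)) := by
      have : (volume : Measure ℝ).prod (volume.restrict s)
          = (volume : Measure (ℝ × ℝ)).restrict (univ ×ˢ s) := by
        rw [Measure.volume_eq_prod, ← Measure.prod_restrict, Measure.restrict_univ]
      rw [this]
      exact hH.integrableOn
    exact h2.integral_prod_left
  simp only [intervalIntegral]
  exact (h1 _).sub (h1 _)

lemma aux_ae_section {H : ℝ × ℝ → ℝ} (hH : Integrable H) :
    ∀ᵐ u : ℝ, Integrable (fun v : ℝ => H (u, v)) := by
  rw [Measure.volume_eq_prod] at hH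
  exact hH.prod_right_ae

open Filter Topology in
lemma aux_nonneg {H : ℝ × ℝ → ℝ} (hH : Integrable H) (h0 : ∀ p, 0 ≤ H p) :
    ∀ᵐ x : ℝ, ∀ t : ℝ, HasDerivAt (fun s => ∫ u in (0:ℝ)..s, ∫ v in (0:ℝ)..t, H (u, v))
      (∫ v in (0:ℝ)..t, H (x, v)) x := by
  have hq : ∀ᵐ x : ℝ, ∀ q : ℚ,
      HasDerivAt (fun s => ∫ u in (0:ℝ)..s, ∫ v in (0:ℝ)..(q:ℝ), H (u, v))
      (∫ v in (0:ℝ)..(q:ℝ), H (x, v)) x := by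
    rw [ae_all_iff]
    intro q
    filter_upwards [LocallyIntegrable.ae_hasDerivAt_integral
      (aux_inner_integrable hH (q:ℝ)).locallyIntegrable] with x hx
    exact hx 0
  have hmono : ∀ q t : ℝ, q ≤ t → ∀ x s : ℝ,
      slope (fun s => ∫ u in (0:ℝ)..s, ∫ v in (0:ℝ)..q, H (u, v)) x s ≤
      slope (fun s => ∫ u in (0:ℝ)..s, ∫ v in (0:ℝ)..t, H (u, v)) x s := by
    intro q t hqt x s
    have hii : ∀ t a b : ℝ, IntervalIntegrable (fun u => ∫ v in (0:ℝ)..t, H (u, v)) volume a b :=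
      fun t a b => (aux_inner_integrable hH t).intervalIntegrable
    have hle : ∀ᵐ u : ℝ, (∫ v in (0:ℝ)..q, H (u, v)) ≤ ∫ v in (0:ℝ)..t, H (u, v) := by
      filter_upwards [aux_ae_section hH] with u hu
      rw [← sub_nonneg, intervalIntegral.integral_interval_sub_left
        hu.intervalIntegrable hu.intervalIntegrable]
      exact intervalIntegral.integral_nonneg hqt (fun v _ => h0 _)
    simp only [slope_def_field]
    rw [intervalIntegral.integral_interval_sub_left (hii _ _ _) (hii _ _ _),
      intervalIntegral.integral_interval_sub_left (hii _ _ _) (hii _ _ _)]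
    rcases le_total x s with hxs | hxs
    · exact div_le_div_of_nonneg_right
        (intervalIntegral.integral_mono_ae hxs (hii _ _ _) (hii _ _ _) hle) (by linarith)
    · apply div_le_div_of_nonpos_of_le (by linarith)
      rw [intervalIntegral.integral_symm s x, intervalIntegral.integral_symm s x]
      exact neg_le_neg
        (intervalIntegral.integral_mono_ae hxs (hii _ _ _) (hii _ _ _) hle)
  filter_upwards [hq, aux_ae_section hH] with x hx hix t
  have hcont : Continuous (fun t : ℝ => ∫ v in (0:ℝ)..t, H (x, v)) :=
    intervalIntegral.continuous_primitive (fun a b => hix.intervalIntegrable) 0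
  rw [hasDerivAt_iff_tendsto_slope]
  rw [tendsto_order]
  constructor
  · intro a ha
    have h1 : ∀ᶠ r in 𝓝[<] t, a < ∫ v in (0:ℝ)..r, H (x, v) :=
      nhdsWithin_le_nhds (hcont.continuousAt.eventually (lt_mem_nhds ha))
    obtain ⟨l, hl, hl'⟩ := (mem_nhdsLT_iff_exists_Ioo_subset).1 h1
    obtain ⟨q, hq1, hq2⟩ := exists_rat_btwn (show l < t from hl)
    have h2 : a < ∫ v in (0:ℝ)..(q:ℝ), H (x, v) := hl' ⟨hq1, hq2⟩
    have h3 := (hasDerivAt_iff_tendsto_slope.1 (hx q)).eventually (lt_mem_nhds h2)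
    filter_upwards [h3] with s hs
    exact hs.trans_le (hmono _ _ hq2.le x s)
  · intro a ha
    have h1 : ∀ᶠ r in 𝓝[>] t, (∫ v in (0:ℝ)..r, H (x, v)) < a :=
      nhdsWithin_le_nhds (hcont.continuousAt.eventually (gt_mem_nhds ha))
    obtain ⟨l, hl, hl'⟩ := (mem_nhdsGT_iff_exists_Ioo_subset).1 h1
    obtain ⟨q, hq1, hq2⟩ := exists_rat_btwn (show t < l from hl)
    have h2 : (∫ v in (0:ℝ)..(q:ℝ), H (x, v)) < a := hl' ⟨hq1, hq2⟩
    have h3 := (hasDerivAt_iff_tendsto_slope.1 (hx q)).eventually (gt_mem_nhds h2)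
    filter_upwards [h3] with s hs
    exact (hmono _ _ hq1.le x s).trans_lt hs

lemma aux_first {H : ℝ × ℝ → ℝ} (hH : Integrable H) :
    ∀ᵐ x : ℝ, ∀ t : ℝ, HasDerivAt (fun s => ∫ u in (0:ℝ)..s, ∫ v in (0:ℝ)..t, H (u, v))
      (∫ v in (0:ℝ)..t, H (x, v)) x := by
  have hp := hH.pos_part
  have hn := hH.neg_part
  have key : ∀ᵐ u : ℝ, ∀ t : ℝ, (∫ v in (0:ℝ)..t, H (u, v)) =
      (∫ v in (0:ℝ)..t, max (H (u, v)) 0) - ∫ v in (0:ℝ)..t, max (-H (u, v)) 0 := by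
    filter_upwards [aux_ae_section hp, aux_ae_section hn] with u h1 h2 t
    rw [← intervalIntegral.integral_sub h1.intervalIntegrable h2.intervalIntegrable]
    congr 1
    ext v
    rcases le_total (H (u, v)) 0 with h | h
    · rw [max_eq_right h, max_eq_left (by linarith)]; ring
    · rw [max_eq_left h, max_eq_right (by linarith)]; ring
  have key2 : ∀ t s : ℝ, (∫ u in (0:ℝ)..s, ∫ v in (0:ℝ)..t, H (u, v)) =
      (∫ u in (0:ℝ)..s, ∫ v in (0:ℝ)..t, max (H (u, v)) 0)
      - ∫ u in (0:ℝ)..s, ∫ v in (0:ℝ)..t, max (-H (u, v)) 0 := by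
    intro t s
    rw [← intervalIntegral.integral_sub (aux_inner_integrable hp t).intervalIntegrable
      (aux_inner_integrable hn t).intervalIntegrable]
    apply intervalIntegral.integral_congr_ae
    filter_upwards [key] with u hu _
    exact hu t
  filter_upwards [key, aux_nonneg hp (fun _ => le_max_right _ _),
    aux_nonneg hn (fun _ => le_max_right _ _)] with x h1 h2 h3 t
  simp only [key2]
  rw [h1]
  exact (h2 t).sub (h3 t)

lemma aux_prim_meas {H : ℝ × ℝ → ℝ} (hm : StronglyMeasurable H) :
    Measurable (fun p : ℝ × ℝ => ∫ v in (0:ℝ)..p.2, H (p.1, v)) := by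
  have e : ∀ p : ℝ × ℝ, (∫ v in (0:ℝ)..p.2, H (p.1, v)) =
      (∫ v, {z : (ℝ × ℝ) × ℝ | 0 < z.2 ∧ z.2 ≤ z.1.2}.indicator (fun z => H (z.1.1, z.2)) (p, v))
      - ∫ v, {z : (ℝ × ℝ) × ℝ | z.1.2 < z.2 ∧ z.2 ≤ 0}.indicator
          (fun z => H (z.1.1, z.2)) (p, v) := by
    intro p
    rw [intervalIntegral, ← integral_indicator measurableSet_Ioc,
      ← integral_indicator measurableSet_Ioc]
    rfl
  simp only [e]
  have hm2 : StronglyMeasurable (fun z : (ℝ × ℝ) × ℝ => H (z.1.1, z.2)) :=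
    hm.comp_measurable (by fun_prop)
  have m1 : MeasurableSet {z : (ℝ × ℝ) × ℝ | 0 < z.2 ∧ z.2 ≤ z.1.2} := by
    have i1 : MeasurableSet {z : (ℝ × ℝ) × ℝ | 0 < z.2} :=
      measurableSet_lt (by fun_prop) (by fun_prop)
    have i2 : MeasurableSet {z : (ℝ × ℝ) × ℝ | z.2 ≤ z.1.2} :=
      measurableSet_le (by fun_prop) (by fun_prop)
    exact i1.inter i2
  have m2 : MeasurableSet {z : (ℝ × ℝ) × ℝ | z.1.2 < z.2 ∧ z.2 ≤ 0} := by
    have i1 : MeasurableSet {z : (ℝ × ℝ) × ℝ | z.1.2 < z.2} :=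
      measurableSet_lt (by fun_prop) (by fun_prop)
    have i2 : MeasurableSet {z : (ℝ × ℝ) × ℝ | z.2 ≤ 0} :=
      measurableSet_le (by fun_prop) (by fun_prop)
    exact i1.inter i2
  exact (hm2.indicator m1).integral_prod_right'.measurable.sub
    (hm2.indicator m2).integral_prod_right'.measurable

open Filter Topology in
lemma aux_rat {P : ℝ → ℝ} (hP : Continuous P) (c y : ℝ) :
    HasDerivAt P c y ↔ ∀ n : ℕ, ∃ m : ℕ, ∀ r : ℚ, |(r:ℝ)| < 1 / ((m:ℝ) + 1) →
      |P (y + r) - P y - r * c| ≤ 1 / ((n:ℝ) + 1) * |(r:ℝ)| := by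
  rw [hasDerivAt_iff_isLittleO_nhds_zero, Asymptotics.isLittleO_iff]
  simp only [Real.norm_eq_abs, smul_eq_mul]
  constructor
  · intro h n
    have h1 := h (c := 1 / ((n:ℝ) + 1)) (by positivity)
    obtain ⟨δ, hδ, h2⟩ := Metric.eventually_nhds_iff.1 h1
    obtain ⟨m, hm⟩ := exists_nat_one_div_lt hδ
    refine ⟨m, fun r hr => h2 ?_⟩
    rw [Real.dist_eq, sub_zero]
    exact hr.trans hm
  · intro h ε hε
    obtain ⟨n, hn⟩ := exists_nat_one_div_lt hε
    obtain ⟨m, hm⟩ := h n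
    have hpos : (0:ℝ) < 1 / ((m:ℝ) + 1) := by positivity
    have hcl : IsClosed {r : ℝ | |P (y + r) - P y - r * c| ≤ 1 / ((n:ℝ) + 1) * |r|} :=
      isClosed_le (by fun_prop) (by fun_prop)
    have hsub : Metric.ball (0:ℝ) (1 / ((m:ℝ) + 1)) ⊆
        {r : ℝ | |P (y + r) - P y - r * c| ≤ 1 / ((n:ℝ) + 1) * |r|} := by
      refine (Dense.open_subset_closure_inter (Rat.denseRange_cast (𝕜 := ℝ))
        Metric.isOpen_ball).trans (closure_minimal ?_ hcl)
      rintro _ ⟨hr, ⟨r, rfl⟩⟩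
      apply hm
      rwa [Metric.mem_ball, Real.dist_eq, sub_zero] at hr
    filter_upwards [Metric.ball_mem_nhds (0:ℝ) hpos] with r hr
    exact (hsub hr).trans (mul_le_mul_of_nonneg_right hn.le (abs_nonneg r))

lemma aux_main {H : ℝ × ℝ → ℝ} (hH : Integrable H) (hm : StronglyMeasurable H) :
    ∀ᵐ p : ℝ × ℝ,
      (∀ t : ℝ, HasDerivAt (fun s => ∫ u in (0:ℝ)..s, ∫ v in (0:ℝ)..t, H (u, v))
        (∫ v in (0:ℝ)..t, H (p.1, v)) p.1) ∧
      HasDerivAt (fun t => ∫ v in (0:ℝ)..t, H (p.1, v)) (H p) p.2 := by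
  have hfst : Measure.QuasiMeasurePreserving (Prod.fst : ℝ × ℝ → ℝ) volume volume :=
    Measure.quasiMeasurePreserving_fst
  have hcont : ∀ x : ℝ, Integrable (fun v : ℝ => H (x, v)) →
      Continuous (fun t : ℝ => ∫ v in (0:ℝ)..t, H (x, v)) := fun x hix =>
    intervalIntegral.continuous_primitive (fun a b => hix.intervalIntegrable) 0
  have hP := aux_prim_meas hm
  have hmH := hm.measurable
  have h2 : ∀ᵐ p : ℝ × ℝ, ∀ n : ℕ, ∃ m : ℕ, ∀ r : ℚ, |(r:ℝ)| < 1 / ((m:ℝ) + 1) →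
      |(∫ v in (0:ℝ)..(p.2 + r), H (p.1, v)) - (∫ v in (0:ℝ)..p.2, H (p.1, v)) - r * H p|
        ≤ 1 / ((n:ℝ) + 1) * |(r:ℝ)| := by
    rw [Measure.volume_eq_prod, Measure.ae_prod_iff_ae_ae]
    · filter_upwards [aux_ae_section hH] with x hix
      filter_upwards [LocallyIntegrable.ae_hasDerivAt_integral hix.locallyIntegrable] with y hy
      exact (aux_rat (hcont x hix) _ y).1 (hy 0)
    · simp only [ofPred_forall, ofPred_exists]
      refine MeasurableSet.iInter fun n => MeasurableSet.iUnion fun m =>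
        MeasurableSet.iInter fun r => MeasurableSet.iInter fun _ => ?_
      have hPr : Measurable (fun p : ℝ × ℝ => ∫ v in (0:ℝ)..(p.2 + r), H (p.1, v)) :=
        hP.comp (g := fun p : ℝ × ℝ => ∫ v in (0:ℝ)..p.2, H (p.1, v))
          (f := fun p : ℝ × ℝ => (p.1, p.2 + (r:ℝ))) (by fun_prop)
      have hb : Measurable (fun p : ℝ × ℝ => (∫ v in (0:ℝ)..(p.2 + r), H (p.1, v))
          - (∫ v in (0:ℝ)..p.2, H (p.1, v)) - r * H p) :=
        (hPr.sub hP).sub (hmH.const_mul _)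
      refine measurableSet_le ?_ measurable_const
      exact continuous_abs.measurable.comp hb
  filter_upwards [hfst.ae (aux_first hH), hfst.ae (aux_ae_section hH), h2] with p h1 h3 h4
  exact ⟨h1, (aux_rat (hcont _ h3) _ _).2 h4⟩

lemma aux_swap {H : ℝ × ℝ → ℝ} (hH : Integrable H) (x y : ℝ) :
    (∫ u in (0:ℝ)..x, ∫ v in (0:ℝ)..y, H (u, v)) = ∫ v in (0:ℝ)..y, ∫ u in (0:ℝ)..x, H (u, v) := by
  exact intervalIntegral_intervalIntegral_swap (F := fun u v => H (u, v)) hH.integrableOn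

theorem stmt14 (h : ℝ → ℝ → ℝ)
    (hint : IntegrableOn (fun p : ℝ × ℝ => h p.1 p.2) (Icc (0:ℝ) 1 ×ˢ Icc (0:ℝ) 1) volume)
    (f : ℝ → ℝ → ℝ)
    (hf : ∀ x ∈ Icc (0:ℝ) 1, ∀ y ∈ Icc (0:ℝ) 1,
      f x y = ∫ u in (0:ℝ)..x, ∫ v in (0:ℝ)..y, h u v) :
    ∀ᵐ p ∂(volume.restrict (Icc (0:ℝ) 1 ×ˢ Icc (0:ℝ) 1)),
      DifferentiableWithinAt ℝ (fun s => f s p.2) (Icc (0:ℝ) 1) p.1 ∧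
      DifferentiableWithinAt ℝ (fun s => f p.1 s) (Icc (0:ℝ) 1) p.2 ∧
      HasDerivWithinAt (fun t => derivWithin (fun s => f s t) (Icc (0:ℝ) 1) p.1)
        (h p.1 p.2) (Icc (0:ℝ) 1) p.2 ∧
      HasDerivWithinAt (fun t => derivWithin (fun s => f t s) (Icc (0:ℝ) 1) p.2)
        (h p.1 p.2) (Icc (0:ℝ) 1) p.1 := by
  have hS : MeasurableSet (Icc (0:ℝ) 1 ×ˢ Icc (0:ℝ) 1) := measurableSet_Icc.prod measurableSet_Icc
  have hI := hint.integrable_indicator hS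
  obtain ⟨H, hm, hHeq⟩ := hI.aestronglyMeasurable
  have hH : Integrable H := hI.congr hHeq
  have hHeq' : ∀ᵐ u : ℝ, ∀ᵐ v : ℝ, (Icc (0:ℝ) 1 ×ˢ Icc (0:ℝ) 1).indicator
      (fun p : ℝ × ℝ => h p.1 p.2) (u, v) = H (u, v) := by
    rw [Measure.volume_eq_prod] at hHeq
    exact Measure.ae_ae_of_ae_prod hHeq
  have hfF : ∀ x ∈ Icc (0:ℝ) 1, ∀ y ∈ Icc (0:ℝ) 1,
      f x y = ∫ u in (0:ℝ)..x, ∫ v in (0:ℝ)..y, H (u, v) := by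
    intro x hx y hy
    rw [hf x hx y hy]
    apply intervalIntegral.integral_congr_ae
    filter_upwards [hHeq'] with u hu hux
    rw [uIoc_of_le hx.1] at hux
    apply intervalIntegral.integral_congr_ae
    filter_upwards [hu] with v hv hvy
    rw [uIoc_of_le hy.1] at hvy
    rw [← hv, indicator_of_mem]
    exact ⟨⟨hux.1.le, hux.2.trans hx.2⟩, ⟨hvy.1.le, hvy.2.trans hy.2⟩⟩
  have hmp : MeasurePreserving (Prod.swap : ℝ × ℝ → ℝ × ℝ) volume volume :=
    Measure.measurePreserving_swap
  have hH' : Integrable (fun p : ℝ × ℝ => H p.swap) := hH.swap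
  have hm' : StronglyMeasurable (fun p : ℝ × ℝ => H p.swap) := hm.comp_measurable measurable_swap
  have A := aux_main hH hm
  have B := hmp.quasiMeasurePreserving.ae (aux_main hH' hm')
  rw [ae_restrict_iff' hS]
  filter_upwards [A, B, hHeq] with p hA hB hp hpS
  rw [indicator_of_mem hpS] at hp
  obtain ⟨hx, hy⟩ := hpS
  obtain ⟨A1, A2⟩ := hA
  obtain ⟨B1, B2⟩ := hB
  simp only [Prod.fst_swap, Prod.snd_swap, Prod.swap_prod_mk, Prod.swap_swap] at B1 B2
  have C1 : ∀ t ∈ Icc (0:ℝ) 1, HasDerivWithinAt (fun s => f s t)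
      (∫ v in (0:ℝ)..t, H (p.1, v)) (Icc (0:ℝ) 1) p.1 := fun t ht =>
    (A1 t).hasDerivWithinAt.congr (fun s hs => hfF s hs t ht) (hfF _ hx t ht)
  have C2 : ∀ t ∈ Icc (0:ℝ) 1, HasDerivWithinAt (fun s => f t s)
      (∫ u in (0:ℝ)..t, H (u, p.2)) (Icc (0:ℝ) 1) p.2 := fun t ht =>
    (B1 t).hasDerivWithinAt.congr (fun s hs => (hfF t ht s hs).trans (aux_swap hH t s))
      ((hfF t ht _ hy).trans (aux_swap hH t _))
  have hu := uniqueDiffOn_Icc (zero_lt_one' ℝ)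
  refine ⟨(C1 _ hy).differentiableWithinAt, (C2 _ hx).differentiableWithinAt, ?_, ?_⟩
  · rw [hp]
    exact A2.hasDerivWithinAt.congr (fun t ht => (C1 t ht).derivWithin (hu _ hx))
      ((C1 _ hy).derivWithin (hu _ hx))
  · rw [hp]
    exact B2.hasDerivWithinAt.congr (fun t ht => (C2 t ht).derivWithin (hu _ hy))
      ((C2 _ hx).derivWithin (hu _ hy))
end

section
/- Let f : [0,1]² → ℝ be separately twice differentiable (so that the pure second partial derivatives f''_{xx} and f''_{yy} exist at every point of [0,1]²). Then there exists an open dense set G ⊆ [0,1]² such that at almost every point of G the mixed second partial derivatives f''_{xy} and f''_{yx} exist and are equal. -/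
open MeasureTheory Set
open Filter Topology

/-- Lebesgue differentiation for `x ↦ ∫_{Iic x} k`. -/
lemma ae_hasDerivAt_Iic {k : ℝ → ℝ} (hk : Integrable k) :
    ∀ᵐ x, HasDerivAt (fun z => ∫ t in Iic z, k t) (k x) x := by
  filter_upwards [LocallyIntegrable.ae_hasDerivAt_integral hk.locallyIntegrable] with x hx
  have h := (hx 0).const_add (∫ t in Iic (0:ℝ), k t)
  refine h.congr_of_eventuallyEq (Eventually.of_forall fun z => ?_)
  have := intervalIntegral.integral_Iic_sub_Iic (f := k) (μ := volume) (a := 0) (b := z)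
    hk.integrableOn hk.integrableOn
  simp only
  linarith

lemma continuous_Iic {k : ℝ → ℝ} (hk : Integrable k) :
    Continuous (fun z => ∫ t in Iic z, k t) := by
  have : (fun z => ∫ t in Iic z, k t) = fun z => (∫ t in Iic (0:ℝ), k t) + ∫ t in (0:ℝ)..z, k t := by
    funext z
    have := intervalIntegral.integral_Iic_sub_Iic (f := k) (μ := volume) (a := 0) (b := z)
      hk.integrableOn hk.integrableOn
    linarith
  rw [this]
  exact continuous_const.add (intervalIntegral.continuous_primitive (fun a b => hk.intervalIntegrable) 0)

lemma mixed_of_primitive (F Fx : ℝ → ℝ → ℝ) (g : ℝ × ℝ → ℝ) (hg : Integrable g)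
    (hgm : Measurable g)
    (hF : ∀ x y, F x y = ∫ p in Iic x ×ˢ Iic y, g p)
    (hFx : ∀ x y, HasDerivAt (fun t => F t y) (Fx x y) x)
    (hc : Continuous (Function.uncurry Fx)) :
    ∀ᵐ p : ℝ × ℝ, HasDerivAt (fun t => Fx p.1 t) (g p) p.2 := by
  have hmeas : MeasurableSet {p : ℝ × ℝ | HasDerivAt (fun t => Fx p.1 t) (g p) p.2} := by
    have h1 := measurableSet_of_differentiableAt_with_param ℝ (f := Fx) hc
    have h2 := measurable_deriv_with_param (f := Fx) hc
    have : {p : ℝ × ℝ | HasDerivAt (fun t => Fx p.1 t) (g p) p.2} =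
        {p : ℝ × ℝ | DifferentiableAt ℝ (Fx p.1) p.2} ∩ {p | deriv (Fx p.1) p.2 = g p} := by
      ext p
      constructor
      · intro h
        exact ⟨h.differentiableAt, h.deriv⟩
      · rintro ⟨h, h'⟩
        have := h.hasDerivAt
        rw [h'] at this
        exact this
    rw [this]
    exact h1.inter (measurableSet_eq_fun h2 hgm)
  rw [Measure.volume_eq_prod] at hg ⊢
  rw [Measure.ae_prod_iff_ae_ae hmeas]
  -- integrability of slices
  have hs : ∀ᵐ x : ℝ, Integrable (fun t => g (x, t)) := hg.prod_right_ae
  have hK : ∀ y, Integrable (fun s : ℝ => ∫ t in Iic y, g (s, t)) := by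
    intro y
    have : Integrable g ((volume : Measure ℝ).prod (volume.restrict (Iic y))) := by
      have h := hg.restrict (s := univ ×ˢ Iic y)
      rwa [← Measure.prod_restrict, Measure.restrict_univ] at h
    exact this.integral_prod_left
  have hF2 : ∀ x y, F x y = ∫ s in Iic x, ∫ t in Iic y, g (s, t) := by
    intro x y
    rw [hF, Measure.volume_eq_prod, setIntegral_prod]
    exact hg.integrableOn
  have hrat : ∀ᵐ x : ℝ, ∀ q : ℚ, Fx x q = ∫ t in Iic (q:ℝ), g (x, t) := by
    rw [ae_all_iff]
    intro q
    filter_upwards [ae_hasDerivAt_Iic (hK q)] with x hx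
    have h2 := hFx x q
    simp only [hF2] at h2
    exact h2.unique hx
  filter_upwards [hrat, hs] with x hx hsx
  have heq : (fun y => Fx x y) = fun y => ∫ t in Iic y, g (x, t) := by
    refine Continuous.ext_on Rat.isDenseEmbedding_coe_real.dense ?_ (continuous_Iic hsx) ?_
    · exact hc.comp (continuous_const.prodMk continuous_id)
    · rintro _ ⟨q, rfl⟩
      exact hx q
  rw [heq]
  exact ae_hasDerivAt_Iic hsx

lemma weak_limit {H : Type*} [NormedAddCommGroup H] [InnerProductSpace ℝ H] [CompleteSpace H]
    (g : ℕ → H) (C : ℝ) (hC : ∀ n, ‖g n‖ ≤ C) :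
    ∃ w : H, ∀ v : H, Tendsto (fun n => inner ℝ (g n) v) (hyperfilter ℕ : Filter ℕ)
      (𝓝 (inner ℝ w v)) := by
  have hcpt := WeakDual.isCompact_closedBall (𝕜 := ℝ) (E := H) 0 C
  let G : ℕ → WeakDual ℝ H := fun n => StrongDual.toWeakDual (InnerProductSpace.toDual ℝ H (g n))
  have := hcpt.ultrafilter_le_nhds ((hyperfilter ℕ).map G) (by
    rw [Ultrafilter.coe_map, le_principal_iff, mem_map]
    refine Eventually.of_forall fun n => ?_
    simp [G]
    exact hC n)
  obtain ⟨ℓ, -, hl⟩ := this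
  refine ⟨(InnerProductSpace.toDual ℝ H).symm (WeakDual.toStrongDual ℓ), fun v => ?_⟩
  have h2 : Tendsto G (hyperfilter ℕ : Filter ℕ) (𝓝 ℓ) := hl
  have h3 := ((WeakDual.eval_continuous v).tendsto ℓ).comp h2
  rw [InnerProductSpace.toDual_symm_apply]
  exact h3

/-- Forward difference. -/
def fdiff (e : ℝ × ℝ) (u : ℝ × ℝ → ℝ) : ℝ × ℝ → ℝ := fun p => u (p + e) - u p

lemma fdiff_continuous (e : ℝ × ℝ) {u : ℝ × ℝ → ℝ} (hu : Continuous u) : Continuous (fdiff e u) := by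
  unfold fdiff; fun_prop

lemma fdiff_cs (e : ℝ × ℝ) {u : ℝ × ℝ → ℝ} (hu : HasCompactSupport u) :
    HasCompactSupport (fdiff e u) := by
  have := hu.comp_homeomorph (Homeomorph.addRight e)
  exact this.sub hu

lemma fdiff_comm (a b : ℝ × ℝ) (u : ℝ × ℝ → ℝ) : fdiff a (fdiff b u) = fdiff b (fdiff a u) := by
  funext p
  simp only [fdiff, add_right_comm p a b]
  ring

lemma fdiff_adjoint (e : ℝ × ℝ) {u v : ℝ × ℝ → ℝ} (hu : Continuous u) (hc : HasCompactSupport u)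
    (hv : LocallyIntegrable v) :
    ∫ p, fdiff e u p * v p = ∫ p, u p * fdiff (-e) v p := by
  have i1 : Integrable (fun p => u p * v p) :=
    hv.integrable_smul_left_of_hasCompactSupport hu hc
  have i2 : Integrable (fun p => u (p + e) * v p) :=
    hv.integrable_smul_left_of_hasCompactSupport (g := fun p => u (p + e)) (by fun_prop)
      (hc.comp_homeomorph (Homeomorph.addRight e))
  have i3 : Integrable (fun p => u p * v (p + -e)) := by
    have := i2.comp_add_right (-e)
    simpa using this
  have e1 : ∫ p, u (p + e) * v p = ∫ p, u p * v (p + -e) := by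
    have := integral_add_right_eq_self (μ := volume) (fun p => u (p + e) * v p) (-e)
    simpa using this.symm
  simp only [fdiff, sub_mul, mul_sub]
  rw [integral_sub i2 i1, integral_sub i3 i1, e1]

lemma fdiff_energy (a b : ℝ × ℝ) {u : ℝ × ℝ → ℝ} (hu : Continuous u) (hc : HasCompactSupport u) :
    ∫ p, fdiff a (fdiff b u) p * fdiff a (fdiff b u) p =
      ∫ p, fdiff (-a) (fdiff a u) p * fdiff (-b) (fdiff b u) p := by
  have hb := fdiff_continuous b hu
  have hbc := fdiff_cs b hc
  have hW := fdiff_continuous (-a) (fdiff_continuous a hu)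
  have hWc := fdiff_cs (-a) (fdiff_cs a hc)
  rw [fdiff_adjoint a hb hbc (fdiff_continuous a hb).locallyIntegrable,
    fdiff_comm a b u, fdiff_comm (-a) b]
  rw [← fdiff_adjoint b hW hWc hb.locallyIntegrable]
  congr 1; funext p; ring

lemma mvt_point {φ φ1 : ℝ → ℝ} (h : ∀ x, HasDerivAt φ (φ1 x) x) (x k : ℝ) (hk : 0 < k) :
    ∃ c ∈ Ioo x (x + k), φ (x + k) - φ x = k * φ1 c := by
  obtain ⟨c, hc, e⟩ := exists_hasDerivAt_eq_slope φ φ1 (by linarith : x < x + k)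
    (fun z _ => (h z).continuousAt.continuousWithinAt) (fun z _ => h z)
  refine ⟨c, hc, ?_⟩
  rw [e, add_sub_cancel_left]
  field_simp

lemma lip_of_deriv {φ φ1 : ℝ → ℝ} {M : ℝ} (h : ∀ x, HasDerivAt φ (φ1 x) x)
    (hb : ∀ x, |φ1 x| ≤ M) (x z : ℝ) : |φ x - φ z| ≤ M * |x - z| :=
  Convex.norm_image_sub_le_of_norm_hasDerivWithin_le (s := univ) (f := φ) (f' := φ1)
    (fun w _ => (h w).hasDerivWithinAt) (fun w _ => hb w) convex_univ (mem_univ z) (mem_univ x)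

lemma second_diff {φ φ1 φ2 : ℝ → ℝ} {M : ℝ} (h : ∀ x, HasDerivAt φ (φ1 x) x)
    (h1 : ∀ x, HasDerivAt φ1 (φ2 x) x)
    (hb : ∀ x, |φ2 x| ≤ M) (x k : ℝ) (hk : 0 < k) :
    |φ x - φ (x - k) - (φ (x + k) - φ x)| ≤ 2 * M * k ^ 2 := by
  obtain ⟨c, hc, e⟩ := mvt_point h x k hk
  obtain ⟨d, hd, e'⟩ := mvt_point h (x - k) k hk
  have hM : 0 ≤ M := (abs_nonneg _).trans (hb 0)
  rw [sub_add_cancel] at e' hd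
  rw [e, e', ← mul_sub, abs_mul, abs_of_pos hk]
  have := lip_of_deriv h1 hb d c
  have h3 : |d - c| ≤ 2 * k := by
    rw [abs_le]; constructor <;> linarith [hc.1, hc.2, hd.1, hd.2]
  calc k * |φ1 d - φ1 c| ≤ k * (M * (2 * k)) := by gcongr; exact this.trans (by gcongr)
    _ = _ := by ring

lemma deriv_bound {φ φ1 φ2 : ℝ → ℝ} {M : ℝ} (h : ∀ x, HasDerivAt φ (φ1 x) x)
    (h1 : ∀ x, HasDerivAt φ1 (φ2 x) x)
    (hb : ∀ x, |φ2 x| ≤ M) (h0 : ∀ x, x ∉ Icc (0:ℝ) 1 → φ x = 0) (x : ℝ) : |φ1 x| ≤ 4 * M := by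
  have hM : 0 ≤ M := (abs_nonneg _).trans (hb 0)
  have hout : ∀ x, x ∉ Icc (0:ℝ) 1 → φ1 x = 0 := by
    intro x hx
    have he : φ =ᶠ[𝓝 x] fun _ => 0 := by
      filter_upwards [isClosed_Icc.isOpen_compl.mem_nhds hx] with z hz using h0 z hz
    exact (h x).unique ((hasDerivAt_const x (0:ℝ)).congr_of_eventuallyEq he)
  by_cases hx : x ∈ Icc (0:ℝ) 1
  · have := lip_of_deriv h1 hb x 2
    rw [hout 2 (by norm_num), sub_zero] at this
    refine this.trans ?_
    rw [mul_comm]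
    gcongr
    rw [abs_le]; constructor <;> linarith [hx.1, hx.2]
  · rw [hout x hx, abs_zero]; positivity

lemma uncurry_cont (F Fx Fy Fxx Fyy : ℝ → ℝ → ℝ) (M : ℝ)
    (hFx : ∀ x y, HasDerivAt (fun t => F t y) (Fx x y) x)
    (hFxx : ∀ x y, HasDerivAt (fun t => Fx t y) (Fxx x y) x)
    (hFy : ∀ x y, HasDerivAt (fun t => F x t) (Fy x y) y)
    (hFyy : ∀ x y, HasDerivAt (fun t => Fy x t) (Fyy x y) y)
    (hbx : ∀ x y, |Fxx x y| ≤ M) (hby : ∀ x y, |Fyy x y| ≤ M)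
    (h0 : ∀ x y, ¬ (x ∈ Icc (0:ℝ) 1 ∧ y ∈ Icc (0:ℝ) 1) → F x y = 0) :
    Continuous (Function.uncurry F) := by
  have hM : 0 ≤ M := (abs_nonneg _).trans (hbx 0 0)
  have L1 : ∀ y, LipschitzWith (4 * M).toNNReal (fun x => F x y) := by
    intro y
    refine LipschitzWith.of_dist_le_mul fun x z => ?_
    rw [Real.coe_toNNReal _ (by positivity), Real.dist_eq, Real.dist_eq]
    refine lip_of_deriv (fun x => hFx x y) (fun x => ?_) x z
    exact deriv_bound (fun x => hFx x y) (fun x => hFxx x y) (fun x => hbx x y)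
      (fun x hx => h0 x y (fun h => hx h.1)) x
  have L2 : ∀ x, LipschitzWith (4 * M).toNNReal (F x) := by
    intro x
    refine LipschitzWith.of_dist_le_mul fun y z => ?_
    rw [Real.coe_toNNReal _ (by positivity), Real.dist_eq, Real.dist_eq]
    refine lip_of_deriv (fun y => hFy x y) (fun y => ?_) y z
    exact deriv_bound (fun y => hFy x y) (fun y => hFyy x y) (fun y => hby x y)
      (fun y hy => h0 x y (fun h => hy h.2)) y
  exact (LipschitzWith.uncurry L1 L2).continuous

lemma uncurry_cont_deriv (F Fx Fxx : ℝ → ℝ → ℝ) (M : ℝ)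
    (hFx : ∀ x y, HasDerivAt (fun t => F t y) (Fx x y) x)
    (hFxx : ∀ x y, HasDerivAt (fun t => Fx t y) (Fxx x y) x)
    (hbx : ∀ x y, |Fxx x y| ≤ M)
    (hc : Continuous (Function.uncurry F)) :
    Continuous (Function.uncurry Fx) := by
  have hM : 0 ≤ M := (abs_nonneg _).trans (hbx 0 0)
  have hT : TendstoUniformly (fun (n : ℕ) (p : ℝ × ℝ) =>
      ((n:ℝ) + 1) * (F (p.1 + 1 / ((n:ℝ) + 1)) p.2 - F p.1 p.2)) (Function.uncurry Fx) atTop := by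
    rw [Metric.tendstoUniformly_iff]
    intro ε hε
    have ht : Tendsto (fun n : ℕ => M * (1 / ((n:ℝ) + 1))) atTop (𝓝 (M * 0)) :=
      tendsto_one_div_add_atTop_nhds_zero_nat.const_mul M
    rw [mul_zero] at ht
    filter_upwards [ht.eventually (gt_mem_nhds hε)] with n hn p
    obtain ⟨x, y⟩ := p
    have hk : (0:ℝ) < 1 / ((n:ℝ) + 1) := by positivity
    obtain ⟨c, hcc, e⟩ := mvt_point (fun x => hFx x y) x _ hk
    have e2 : ((n:ℝ) + 1) * (F (x + 1 / ((n:ℝ) + 1)) y - F x y) = Fx c y := by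
      rw [e]; field_simp
    simp only [Function.uncurry, e2]
    rw [Real.dist_eq]
    refine (lip_of_deriv (fun x => hFxx x y) (fun x => hbx x y) x c).trans_lt (lt_of_le_of_lt ?_ hn)
    gcongr
    rw [abs_le]; constructor <;> linarith [hcc.1, hcc.2]
  refine hT.continuous (Frequently.of_forall fun n => ?_)
  have h1 : Continuous fun p : ℝ × ℝ => F p.1 p.2 := hc
  have h2 : Continuous fun p : ℝ × ℝ => F (p.1 + 1 / ((n:ℝ) + 1)) p.2 :=
    hc.comp (f := fun p : ℝ × ℝ => (p.1 + 1 / ((n:ℝ) + 1), p.2)) (by fun_prop)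
  fun_prop

lemma fdiff_indicator (x y h : ℝ) (hh : 0 < h) :
    fdiff (-(0, h)) (fdiff (-(h, 0)) ((Iic x ×ˢ Iic y).indicator fun _ => (1:ℝ))) =
      (Ioc x (x + h) ×ˢ Ioc y (y + h)).indicator fun _ => (1:ℝ) := by
  funext p
  obtain ⟨s, t⟩ := p
  simp only [fdiff, indicator, mem_prod, mem_Iic, mem_Ioc, Prod.fst_add, Prod.snd_add, Prod.fst_neg,
    Prod.snd_neg, neg_zero, add_zero]
  by_cases h1 : s ≤ x <;> by_cases h2 : s + -h ≤ x <;> by_cases h3 : t ≤ y <;>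
    by_cases h4 : t + -h ≤ y <;> first | (exfalso; linarith) | skip
  all_goals
    have h2' : s ≤ x + h ↔ s + -h ≤ x := by constructor <;> intro <;> linarith
    have h4' : t ≤ y + h ↔ t + -h ≤ y := by constructor <;> intro <;> linarith
    have h1' : x < s ↔ ¬ s ≤ x := not_le.symm
    have h3' : y < t ↔ ¬ t ≤ y := not_le.symm
    simp [h2', h4', h1', h3', h1, h2, h3, h4]

lemma avg_tendsto {u : ℝ × ℝ → ℝ} (hu : Continuous u) (x y : ℝ) :
    Tendsto (fun n : ℕ => ((n:ℝ) + 1) ^ 2 *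
      ∫ p in Ioc x (x + 1 / ((n:ℝ) + 1)) ×ˢ Ioc y (y + 1 / ((n:ℝ) + 1)), u p) atTop
      (𝓝 (u (x, y))) := by
  rw [Metric.tendsto_atTop]
  intro ε hε
  obtain ⟨δ, hδ, hd⟩ := Metric.continuous_iff.1 hu (x, y) (ε / 2) (by positivity)
  obtain ⟨N, hN⟩ := (tendsto_one_div_add_atTop_nhds_zero_nat (𝕜 := ℝ)).eventually
    (gt_mem_nhds hδ) |>.exists_forall_of_atTop
  refine ⟨N, fun n hn => ?_⟩
  set h : ℝ := 1 / ((n:ℝ) + 1) with hh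
  have hpos : 0 < h := by positivity
  have hlt : h < δ := hN n hn
  set S := Ioc x (x + h) ×ˢ Ioc y (y + h) with hS
  have hvol : volume S = ENNReal.ofReal (h * h) := by
    rw [hS, Measure.volume_eq_prod, Measure.prod_prod, Real.volume_Ioc, Real.volume_Ioc,
      ← ENNReal.ofReal_mul (by linarith)]
    congr 1; ring
  have hreal : volume.real S = h * h := by
    rw [Measure.real, hvol, ENNReal.toReal_ofReal (by positivity)]
  have hSfin : volume S < ⊤ := by rw [hvol]; exact ENNReal.ofReal_lt_top
  have huS : IntegrableOn u S := by
    refine (hu.continuousOn.integrableOn_compact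
      (isCompact_Icc.prod isCompact_Icc : IsCompact (Icc x (x + h) ×ˢ Icc y (y + h)))).mono_set ?_
    exact prod_mono Ioc_subset_Icc_self Ioc_subset_Icc_self
  have e1 : ((n:ℝ) + 1) ^ 2 * (h * h) = 1 := by rw [hh]; field_simp
  have e2 : ∫ p in S, (u p - u (x, y)) = (∫ p in S, u p) - h * h * u (x, y) := by
    rw [integral_sub huS (integrableOn_const (hs := hSfin.ne)), setIntegral_const, hreal, smul_eq_mul]
  have e3 : ‖∫ p in S, (u p - u (x, y))‖ ≤ ε / 2 * volume.real S := by
    refine norm_setIntegral_le_of_norm_le_const hSfin fun p hp => ?_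
    refine (hd p ?_).le
    obtain ⟨⟨a1, a2⟩, b1, b2⟩ := hp
    rw [Prod.dist_eq, max_lt_iff, Real.dist_eq, Real.dist_eq, abs_lt, abs_lt]
    refine ⟨⟨?_, ?_⟩, ?_, ?_⟩ <;> simp only <;> linarith
  rw [hreal, e2] at e3
  rw [Real.dist_eq]
  have e4 : ((n:ℝ) + 1) ^ 2 * (∫ p in S, u p) - u (x, y) =
      ((n:ℝ) + 1) ^ 2 * ((∫ p in S, u p) - h * h * u (x, y)) := by
    rw [mul_sub, ← mul_assoc, e1, one_mul]
  rw [e4, abs_mul, abs_of_nonneg (by positivity : (0:ℝ) ≤ ((n:ℝ) + 1) ^ 2)]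
  calc _ ≤ ((n:ℝ) + 1) ^ 2 * (ε / 2 * (h * h)) := by gcongr; exact e3
    _ = ε / 2 * (((n:ℝ) + 1) ^ 2 * (h * h)) := by ring
    _ < ε := by rw [e1]; linarith

lemma exists_density (u : ℝ × ℝ → ℝ) (M : ℝ) (hu : Continuous u)
    (h0 : ∀ p, p ∉ Icc (0:ℝ) 1 ×ˢ Icc (0:ℝ) 1 → u p = 0)
    (hx : ∀ p h, 0 < h → |fdiff (-(h, 0)) (fdiff (h, 0) u) p| ≤ M * h ^ 2)
    (hy : ∀ p h, 0 < h → |fdiff (-(0, h)) (fdiff (0, h) u) p| ≤ M * h ^ 2) :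
    ∃ g : ℝ × ℝ → ℝ, Measurable g ∧ Integrable g ∧
      ∀ x y, u (x, y) = ∫ p in Iic x ×ˢ Iic y, g p := by
  have hM : 0 ≤ M := by simpa using (abs_nonneg _).trans (hx 0 1 one_pos)
  have hc : HasCompactSupport u :=
    HasCompactSupport.intro (isCompact_Icc.prod isCompact_Icc) h0
  set B : Set (ℝ × ℝ) := Icc (-2) 2 ×ˢ Icc (-2) 2 with hB
  have hBm : MeasurableSet B := measurableSet_Icc.prod measurableSet_Icc
  have hBc : IsCompact B := isCompact_Icc.prod isCompact_Icc
  have hBfin : volume B < ⊤ := hBc.measure_lt_top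
  set μ : Measure (ℝ × ℝ) := volume.restrict B with hμ
  have : IsFiniteMeasure μ := ⟨by simpa [hμ] using hBfin⟩
  let h : ℕ → ℝ := fun n => 1 / ((n:ℝ) + 1)
  have hpos : ∀ n, 0 < h n := fun n => by positivity
  have hle : ∀ n, h n ≤ 1 := fun n => by
    simp only [h]; rw [div_le_one (by positivity)]; linarith [(n.cast_nonneg : (0:ℝ) ≤ n)]
  let D : ℕ → ℝ × ℝ → ℝ := fun n => fdiff (h n, 0) (fdiff (0, h n) u)
  let G : ℕ → ℝ × ℝ → ℝ := fun n p => ((n:ℝ) + 1) ^ 2 * D n p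
  have hDc : ∀ n, Continuous (D n) := fun n => fdiff_continuous _ (fdiff_continuous _ hu)
  have hDs : ∀ n, HasCompactSupport (D n) := fun n => fdiff_cs _ (fdiff_cs _ hc)
  have hGc : ∀ n, Continuous (G n) := fun n => continuous_const.mul (hDc n)
  have hGs : ∀ n, HasCompactSupport (G n) := fun n => (hDs n).mul_left
  have hz : ∀ p : ℝ × ℝ, p ∉ B → ∀ e : ℝ × ℝ, |e.1| ≤ 1 → |e.2| ≤ 1 → u (p + e) = 0 := by
    intro p hp e he1 he2
    refine h0 _ fun hmem => hp ?_
    obtain ⟨⟨a1, a2⟩, b1, b2⟩ := hmem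
    simp only [Prod.fst_add, Prod.snd_add] at a1 a2 b1 b2
    rw [abs_le] at he1 he2
    refine ⟨⟨?_, ?_⟩, ?_, ?_⟩ <;> linarith [he1.1, he1.2, he2.1, he2.2]
  have habs : ∀ n, |h n| ≤ 1 := fun n => by rw [abs_of_pos (hpos n)]; exact hle n
  have hD0 : ∀ n p, p ∉ B → D n p = 0 := by
    intro n p hp
    simp only [D, fdiff]
    have e1 := hz p hp ((h n, 0) + (0, h n)) (by simpa using habs n) (by simpa using habs n)
    have e2 := hz p hp (h n, 0) (by simpa using habs n) (by simp)
    have e3 := hz p hp (0, h n) (by simp) (by simpa using habs n)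
    have e4 := hz p hp 0 (by simp) (by simp)
    rw [add_zero] at e4
    rw [add_assoc, e1, e2, e3, e4]; simp
  have hW0 : ∀ n p, p ∉ B → fdiff (-(h n, 0)) (fdiff (h n, 0) u) p = 0 := by
    intro n p hp
    simp only [fdiff]
    have e2 := hz p hp (h n, 0) (by simpa using habs n) (by simp)
    have e3 := hz p hp (-(h n, 0)) (by simpa using habs n) (by simp)
    have e4 := hz p hp 0 (by simp) (by simp)
    rw [add_zero] at e4
    rw [neg_add_cancel_right, e2, e3, e4]; simp
  have henergy : ∀ n, ∫ p, G n p * G n p ∂μ ≤ M ^ 2 * volume.real B := by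
    intro n
    have i1 : Integrable (fun p => D n p * D n p) :=
      ((hDc n).mul (hDc n)).integrable_of_hasCompactSupport ((hDs n).mul_left)
    have s1 : ∫ p, D n p * D n p ∂μ ≤ ∫ p, D n p * D n p :=
      setIntegral_le_integral i1 (Eventually.of_forall fun p => mul_self_nonneg _)
    have s2 := fdiff_energy (h n, 0) (0, h n) hu hc
    have s3 : ∫ p, fdiff (-(h n, 0)) (fdiff (h n, 0) u) p * fdiff (-(0, h n)) (fdiff (0, h n) u) p
        = ∫ p in B, fdiff (-(h n, 0)) (fdiff (h n, 0) u) p *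
          fdiff (-(0, h n)) (fdiff (0, h n) u) p := by
      symm
      apply setIntegral_eq_integral_of_forall_compl_eq_zero
      intro p hp
      rw [hW0 n p hp, zero_mul]
    have s4 : ‖∫ p in B, fdiff (-(h n, 0)) (fdiff (h n, 0) u) p *
          fdiff (-(0, h n)) (fdiff (0, h n) u) p‖ ≤ (M * h n ^ 2) * (M * h n ^ 2) * volume.real B := by
      refine norm_setIntegral_le_of_norm_le_const hBfin fun p _ => ?_
      rw [norm_mul]
      have := hpos n
      exact mul_le_mul (hx p _ (hpos n)) (hy p _ (hpos n)) (norm_nonneg _) (by positivity)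
    have s5 : ∫ p, D n p * D n p ∂μ ≤ (M * h n ^ 2) * (M * h n ^ 2) * volume.real B := by
      refine s1.trans (s2.le.trans ?_)
      rw [s3]
      exact (Real.le_norm_self _).trans s4
    have s6 : ∫ p, G n p * G n p ∂μ = (((n:ℝ) + 1) ^ 4) * ∫ p, D n p * D n p ∂μ := by
      rw [← integral_const_mul]
      congr 1; funext p; simp only [G]; ring
    rw [s6]
    calc _ ≤ (((n:ℝ) + 1) ^ 4) * ((M * h n ^ 2) * (M * h n ^ 2) * volume.real B) := by gcongr
      _ = _ := by simp only [h]; field_simp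
  have hmem : ∀ n, MemLp (G n) 2 μ := fun n => (hGc n).memLp_of_hasCompactSupport (hGs n)
  let L : ℕ → Lp ℝ 2 μ := fun n => (hmem n).toLp (G n)
  have hL : ∀ n, ‖L n‖ ≤ Real.sqrt (M ^ 2 * volume.real B) := by
    intro n
    apply Real.le_sqrt_of_sq_le
    rw [← real_inner_self_eq_norm_sq, L2.inner_def]
    refine le_trans (le_of_eq ?_) (henergy n)
    apply integral_congr_ae
    filter_upwards [(hmem n).coeFn_toLp] with p hp
    simp only [L, hp]
    simp [sq]
  obtain ⟨w, hw⟩ := weak_limit L _ hL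
  refine ⟨B.indicator w, ((Lp.stronglyMeasurable w).measurable.indicator hBm), ?_, ?_⟩
  · rw [integrable_indicator_iff hBm]
    exact (Lp.memLp w).integrable (by norm_num)
  intro x y
  set S : Set (ℝ × ℝ) := Iic x ×ˢ Iic y with hS
  have hSm : MeasurableSet S := measurableSet_Iic.prod measurableSet_Iic
  have key : ∀ n, ∫ p in S, L n p ∂μ = ((n:ℝ) + 1) ^ 2 *
      ∫ p in Ioc x (x + h n) ×ˢ Ioc y (y + h n), u p := by
    intro n
    have k1 : ∫ p in S, L n p ∂μ = ∫ p in S, G n p ∂μ :=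
      integral_congr_ae (ae_restrict_of_ae (hmem n).coeFn_toLp)
    have k2 : ∫ p in S, G n p ∂μ = ∫ p in S, G n p := by
      rw [hμ, Measure.restrict_restrict hSm]
      symm
      refine setIntegral_eq_of_subset_of_forall_sdiff_eq_zero hSm inter_subset_left ?_
      intro p hp
      simp only [G]
      rw [hD0 n p (fun hb => hp.2 ⟨hp.1, hb⟩), mul_zero]
    have k3 : ∫ p in S, D n p = ∫ p, D n p * S.indicator (fun _ => (1:ℝ)) p := by
      rw [← integral_indicator hSm]
      congr 1; funext p
      by_cases hp : p ∈ S <;> simp [hp]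
    have hl1 : LocallyIntegrable (S.indicator (fun _ => (1:ℝ))) :=
      (locallyIntegrable_const (1:ℝ)).indicator hSm
    have hl2 : LocallyIntegrable (fdiff (-(h n, 0)) (S.indicator (fun _ => (1:ℝ)))) := by
      have : LocallyIntegrable
          (((fun p => p + (-(h n, 0)))⁻¹' S).indicator (fun _ => (1:ℝ)) : ℝ × ℝ → ℝ) :=
        (locallyIntegrable_const (1:ℝ)).indicator (measurable_add_const _ hSm)
      exact this.sub hl1
    rw [k1, k2]
    simp only [G]
    rw [integral_const_mul, k3]
    congr 1
    rw [fdiff_adjoint _ (fdiff_continuous _ hu) (fdiff_cs _ hc) hl1, fdiff_adjoint _ hu hc hl2,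
      fdiff_indicator x y (h n) (hpos n), ← integral_indicator
        (measurableSet_Ioc.prod measurableSet_Ioc)]
    congr 1; funext p
    by_cases hp : p ∈ Ioc x (x + h n) ×ˢ Ioc y (y + h n)
    · rw [indicator_of_mem hp, indicator_of_mem hp, mul_one]
    · rw [indicator_of_notMem hp, indicator_of_notMem hp, mul_zero]
  have lim1 : Tendsto (fun n => ∫ p in S, L n p ∂μ) (hyperfilter ℕ : Filter ℕ) (𝓝 (u (x, y))) := by
    simp only [key]
    exact (avg_tendsto hu x y).mono_left Nat.hyperfilter_le_atTop
  have lim2 := hw (indicatorConstLp 2 hSm (measure_ne_top μ S) (1:ℝ))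
  simp only [real_inner_comm, L2.inner_indicatorConstLp_one] at lim2
  have := tendsto_nhds_unique lim1 lim2
  have hr : μ.restrict S = volume.restrict (S ∩ B) := Measure.restrict_restrict hSm
  rw [this, real_inner_comm, L2.inner_indicatorConstLp_one, setIntegral_indicator hBm, hr]

lemma mixed_global (F Fx Fy Fxx Fyy : ℝ → ℝ → ℝ) (M : ℝ)
    (hFx : ∀ x y, HasDerivAt (fun t => F t y) (Fx x y) x)
    (hFxx : ∀ x y, HasDerivAt (fun t => Fx t y) (Fxx x y) x)
    (hFy : ∀ x y, HasDerivAt (fun t => F x t) (Fy x y) y)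
    (hFyy : ∀ x y, HasDerivAt (fun t => Fy x t) (Fyy x y) y)
    (hbx : ∀ x y, |Fxx x y| ≤ M) (hby : ∀ x y, |Fyy x y| ≤ M)
    (h0 : ∀ x y, ¬ (x ∈ Icc (0:ℝ) 1 ∧ y ∈ Icc (0:ℝ) 1) → F x y = 0) :
    ∀ᵐ p : ℝ × ℝ, ∃ d : ℝ, HasDerivAt (fun t => Fx p.1 t) d p.2 ∧
      HasDerivAt (fun t => Fy t p.2) d p.1 := by
  have hc := uncurry_cont F Fx Fy Fxx Fyy M hFx hFxx hFy hFyy hbx hby h0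
  have hcx := uncurry_cont_deriv F Fx Fxx M hFx hFxx hbx hc
  have hc' : Continuous (Function.uncurry fun y x => F x y) := hc.comp continuous_swap
  have hcy := uncurry_cont_deriv (fun y x => F x y) (fun y x => Fy x y) (fun y x => Fyy x y) M
    (fun y x => hFy x y) (fun y x => hFyy x y) (fun y x => hby x y) hc'
  obtain ⟨g, hgm, hgi, hg⟩ := exists_density (Function.uncurry F) (2 * M) hc
    (fun p hp => h0 p.1 p.2 hp)
    (fun p h hh => by
      have := second_diff (fun x => hFx x p.2) (fun x => hFxx x p.2) (fun x => hbx x p.2) p.1 h hh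
      simpa [fdiff, Function.uncurry, sub_eq_add_neg, add_assoc, add_comm, add_left_comm] using this)
    (fun p h hh => by
      have := second_diff (fun y => hFy p.1 y) (fun y => hFyy p.1 y) (fun y => hby p.1 y) p.2 h hh
      simpa [fdiff, Function.uncurry, sub_eq_add_neg, add_assoc, add_comm, add_left_comm] using this)
  have r1 := mixed_of_primitive F Fx g hgi hgm hg hFx hcx
  have hgi' : Integrable (g ∘ Prod.swap) := by
    rw [Measure.volume_eq_prod] at hgi ⊢
    exact hgi.swap
  have r2 := mixed_of_primitive (fun y x => F x y) (fun y x => Fy x y) (g ∘ Prod.swap) hgi'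
    (hgm.comp measurable_swap) (fun y x => by
      have := hg x y
      simp only [Function.uncurry] at this
      rw [this, Measure.volume_eq_prod, ← setIntegral_prod_swap]
      rfl) (fun y x => hFy x y) hcy
  have r3 : ∀ᵐ p : ℝ × ℝ, HasDerivAt (fun t => Fy t p.2) (g p) p.1 := by
    have hq : Measure.QuasiMeasurePreserving (Prod.swap : ℝ × ℝ → ℝ × ℝ) volume volume :=
      (Measure.measurePreserving_swap (μ := (volume : Measure ℝ))
        (ν := (volume : Measure ℝ))).quasiMeasurePreserving
    exact hq.ae r2
  filter_upwards [r1, r3] with p h1 h2 using ⟨g p, h1, h2⟩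

lemma exists_bump (a b : ℝ) (hab : a < b) : ∃ (α α1 α2 : ℝ → ℝ) (A a' b' : ℝ),
    (∀ x, HasDerivAt α (α1 x) x) ∧ (∀ x, HasDerivAt α1 (α2 x) x) ∧
    (∀ x, |α x| ≤ A) ∧ (∀ x, |α1 x| ≤ A) ∧ (∀ x, |α2 x| ≤ A) ∧
    (∀ x, x ∉ Ioo a b → α =ᶠ[𝓝 x] fun _ => 0) ∧ a < a' ∧ a' < b' ∧ b' < b ∧
    ∀ x ∈ Ioo a' b', α x = 1 := by
  let B : ContDiffBump ((a + b) / 2 : ℝ) :=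
    ⟨(b - a) / 8, (b - a) / 4, by linarith, by linarith⟩
  have hB : ContDiff ℝ 2 B := B.contDiff
  have h1 : ContDiff ℝ 1 (deriv B) := by
    have : ContDiff ℝ (1 + 1) B := by norm_num; exact hB
    exact (contDiff_succ_iff_deriv.1 this).2.2
  have h2 : Continuous (deriv (deriv B)) := h1.continuous_deriv le_rfl
  have c0 := B.hasCompactSupport
  obtain ⟨A0, hA0⟩ := hB.continuous.bounded_above_of_compact_support c0
  obtain ⟨A1, hA1⟩ := h1.continuous.bounded_above_of_compact_support c0.deriv
  obtain ⟨A2, hA2⟩ := h2.bounded_above_of_compact_support c0.deriv.deriv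
  refine ⟨B, deriv B, deriv (deriv B), max A0 (max A1 A2), (a + b) / 2 - (b - a) / 8,
    (a + b) / 2 + (b - a) / 8, fun x => ?_, fun x => ?_, fun x => ?_, fun x => ?_, fun x => ?_,
    fun x hx => ?_, by linarith, by linarith, by linarith, fun x hx => ?_⟩
  · exact (hB.differentiable (by norm_num) x).hasDerivAt
  · exact (h1.differentiable (by norm_num) x).hasDerivAt
  · exact (hA0 x).trans (le_max_left _ _)
  · exact (hA1 x).trans ((le_max_left _ _).trans (le_max_right _ _))
  · exact (hA2 x).trans ((le_max_right _ _).trans (le_max_right _ _))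
  · refine notMem_tsupport_iff_eventuallyEq.1 fun hm => hx ?_
    rw [B.tsupport_eq, Metric.mem_closedBall, Real.dist_eq, abs_le] at hm
    obtain ⟨m1, m2⟩ := hm
    simp only [B] at m1 m2
    constructor <;> linarith
  · apply B.one_of_mem_closedBall
    rw [Metric.mem_closedBall, Real.dist_eq, abs_le]
    simp only [B]
    constructor <;> linarith [hx.1, hx.2]

lemma cutoff {α α1 α2 φ φ1 φ2 : ℝ → ℝ} {A n a b : ℝ}
    (h1 : ∀ x, HasDerivAt α (α1 x) x) (h2 : ∀ x, HasDerivAt α1 (α2 x) x)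
    (b0 : ∀ x, |α x| ≤ A) (b1 : ∀ x, |α1 x| ≤ A) (b2 : ∀ x, |α2 x| ≤ A)
    (hz : ∀ x, x ∉ Ioo a b → α =ᶠ[𝓝 x] fun _ => 0)
    (k1 : ∀ x ∈ Ioo a b, HasDerivAt φ (φ1 x) x) (k2 : ∀ x ∈ Ioo a b, HasDerivAt φ1 (φ2 x) x)
    (c0 : ∀ x ∈ Ioo a b, |φ x| ≤ n) (c1 : ∀ x ∈ Ioo a b, |φ1 x| ≤ n)
    (c2 : ∀ x ∈ Ioo a b, |φ2 x| ≤ n) (hn : 0 ≤ n) (x : ℝ) :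
    HasDerivAt (fun t => α t * φ t) (α1 x * φ x + α x * φ1 x) x ∧
    HasDerivAt (fun t => α1 t * φ t + α t * φ1 t)
      (α2 x * φ x + α1 x * φ1 x + (α1 x * φ1 x + α x * φ2 x)) x ∧
    |α2 x * φ x + α1 x * φ1 x + (α1 x * φ1 x + α x * φ2 x)| ≤ 4 * (A * n) := by
  have hA : 0 ≤ A := (abs_nonneg _).trans (b0 0)
  by_cases hx : x ∈ Ioo a b
  · refine ⟨(h1 x).mul (k1 x hx), ((h2 x).mul (k1 x hx)).add ((h1 x).mul (k2 x hx)), ?_⟩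
    have e : ∀ s t : ℝ, |s| ≤ A → |t| ≤ n → |s * t| ≤ A * n := fun s t hs ht => by
      rw [abs_mul]; exact mul_le_mul hs ht (abs_nonneg _) hA
    have e1 := abs_le.1 (e _ _ (b2 x) (c0 x hx))
    have e2 := abs_le.1 (e _ _ (b1 x) (c1 x hx))
    have e3 := abs_le.1 (e _ _ (b0 x) (c2 x hx))
    rw [abs_le]; constructor <;> linarith [e1.1, e1.2, e2.1, e2.2, e3.1, e3.2]
  · have z0 := hz x hx
    have z1 : α1 =ᶠ[𝓝 x] fun _ => 0 := by
      filter_upwards [z0.eventually_nhds] with z hz'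
      exact (h1 z).unique ((hasDerivAt_const z (0:ℝ)).congr_of_eventuallyEq hz')
    have z2 : α2 x = 0 := (h2 x).unique ((hasDerivAt_const x (0:ℝ)).congr_of_eventuallyEq z1)
    rw [z2, z1.self_of_nhds, z0.self_of_nhds]
    simp only [zero_mul, add_zero, abs_zero]
    refine ⟨(hasDerivAt_const x (0:ℝ)).congr_of_eventuallyEq ?_,
      (hasDerivAt_const x (0:ℝ)).congr_of_eventuallyEq ?_, by positivity⟩
    · filter_upwards [z0] with z hz'; rw [hz', zero_mul]
    · filter_upwards [z0, z1] with z hz' hz''; rw [hz', hz'', zero_mul, zero_mul, add_zero]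

lemma mixed_local (f fx fy fxx fyy : ℝ → ℝ → ℝ) (a b c d n : ℝ) (ha : 0 ≤ a) (hab : a < b)
    (hb : b ≤ 1) (hc : 0 ≤ c) (hcd : c < d) (hd : d ≤ 1) (hn : 0 ≤ n)
    (hfx : ∀ x ∈ Ioo a b, ∀ y ∈ Ioo c d, HasDerivAt (fun t => f t y) (fx x y) x)
    (hfxx : ∀ x ∈ Ioo a b, ∀ y ∈ Ioo c d, HasDerivAt (fun t => fx t y) (fxx x y) x)
    (hfy : ∀ x ∈ Ioo a b, ∀ y ∈ Ioo c d, HasDerivAt (fun t => f x t) (fy x y) y)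
    (hfyy : ∀ x ∈ Ioo a b, ∀ y ∈ Ioo c d, HasDerivAt (fun t => fy x t) (fyy x y) y)
    (b0 : ∀ x ∈ Ioo a b, ∀ y ∈ Ioo c d, |f x y| ≤ n)
    (bx : ∀ x ∈ Ioo a b, ∀ y ∈ Ioo c d, |fx x y| ≤ n)
    (bxx : ∀ x ∈ Ioo a b, ∀ y ∈ Ioo c d, |fxx x y| ≤ n)
    (bY : ∀ x ∈ Ioo a b, ∀ y ∈ Ioo c d, |fy x y| ≤ n)
    (byy : ∀ x ∈ Ioo a b, ∀ y ∈ Ioo c d, |fyy x y| ≤ n) :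
    ∃ U : Set (ℝ × ℝ), IsOpen U ∧ U.Nonempty ∧ U ⊆ Ioo a b ×ˢ Ioo c d ∧
      ∀ᵐ p : ℝ × ℝ, p ∈ U → ∃ e : ℝ, HasDerivAt (fun t => fx p.1 t) e p.2 ∧
        HasDerivAt (fun t => fy t p.2) e p.1 := by
  obtain ⟨α, α1, α2, A, a', b', hα1, hα2, Ab0, Ab1, Ab2, hαz, haa, hab', hbb, hαone⟩ :=
    exists_bump a b hab
  obtain ⟨β, β1, β2, B, c', d', hβ1, hβ2, Bb0, Bb1, Bb2, hβz, hcc, hcd', hdd, hβone⟩ :=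
    exists_bump c d hcd
  have hA : 0 ≤ A := (abs_nonneg _).trans (Ab0 0)
  have hB : 0 ≤ B := (abs_nonneg _).trans (Bb0 0)
  let F : ℝ → ℝ → ℝ := fun x y => β y * (α x * f x y)
  let Fx : ℝ → ℝ → ℝ := fun x y => β y * (α1 x * f x y + α x * fx x y)
  let Fxx : ℝ → ℝ → ℝ := fun x y =>
    β y * (α2 x * f x y + α1 x * fx x y + (α1 x * fx x y + α x * fxx x y))
  let Fy : ℝ → ℝ → ℝ := fun x y => α x * (β1 y * f x y + β y * fy x y)
  let Fyy : ℝ → ℝ → ℝ := fun x y =>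
    α x * (β2 y * f x y + β1 y * fy x y + (β1 y * fy x y + β y * fyy x y))
  have X : ∀ x y, HasDerivAt (fun t => F t y) (Fx x y) x ∧ HasDerivAt (fun t => Fx t y) (Fxx x y) x
      ∧ |Fxx x y| ≤ 4 * (A * B * n) := by
    intro x y
    by_cases hy : y ∈ Ioo c d
    · obtain ⟨q1, q2, q3⟩ := cutoff hα1 hα2 Ab0 Ab1 Ab2 hαz (fun x hx => hfx x hx y hy)
        (fun x hx => hfxx x hx y hy) (fun x hx => b0 x hx y hy) (fun x hx => bx x hx y hy)
        (fun x hx => bxx x hx y hy) hn x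
      refine ⟨q1.const_mul _, q2.const_mul _, ?_⟩
      simp only [Fxx]
      rw [abs_mul]
      calc _ ≤ B * (4 * (A * n)) := mul_le_mul (Bb0 y) q3 (abs_nonneg _) hB
        _ = _ := by ring
    · have z : β y = 0 := (hβz y hy).self_of_nhds
      simp only [F, Fx, Fxx, z, zero_mul, abs_zero]
      exact ⟨hasDerivAt_const _ _, hasDerivAt_const _ _, by positivity⟩
  have Y : ∀ x y, HasDerivAt (fun t => F x t) (Fy x y) y ∧ HasDerivAt (fun t => Fy x t) (Fyy x y) y
      ∧ |Fyy x y| ≤ 4 * (A * B * n) := by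
    intro x y
    by_cases hx : x ∈ Ioo a b
    · obtain ⟨q1, q2, q3⟩ := cutoff hβ1 hβ2 Bb0 Bb1 Bb2 hβz (fun y hy => hfy x hx y hy)
        (fun y hy => hfyy x hx y hy) (fun y hy => b0 x hx y hy) (fun y hy => bY x hx y hy)
        (fun y hy => byy x hx y hy) hn y
      refine ⟨?_, q2.const_mul _, ?_⟩
      · have := q1.const_mul (α x)
        refine this.congr_of_eventuallyEq (Eventually.of_forall fun t => ?_)
        simp only [F]; ring
      simp only [Fyy]
      rw [abs_mul]
      calc _ ≤ A * (4 * (B * n)) := mul_le_mul (Ab0 x) q3 (abs_nonneg _) hA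
        _ = _ := by ring
    · have z : α x = 0 := (hαz x hx).self_of_nhds
      simp only [F, Fy, Fyy, z, zero_mul, mul_zero, abs_zero]
      exact ⟨hasDerivAt_const _ _, hasDerivAt_const _ _, by positivity⟩
  have G := mixed_global F Fx Fy Fxx Fyy (4 * (A * B * n)) (fun x y => (X x y).1)
    (fun x y => (X x y).2.1) (fun x y => (Y x y).1) (fun x y => (Y x y).2.1)
    (fun x y => (X x y).2.2) (fun x y => (Y x y).2.2) (by
      intro x y hxy
      simp only [F]
      by_cases hx : x ∈ Ioo a b
      · by_cases hy : y ∈ Ioo c d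
        · exact absurd ⟨⟨ha.trans hx.1.le, hx.2.le.trans hb⟩, hc.trans hy.1.le, hy.2.le.trans hd⟩ hxy
        · rw [(hβz y hy).self_of_nhds, zero_mul]
      · rw [(hαz x hx).self_of_nhds, zero_mul, mul_zero])
  have s1 : Ioo a' b' ⊆ Ioo a b := Ioo_subset_Ioo haa.le hbb.le
  have s2 : Ioo c' d' ⊆ Ioo c d := Ioo_subset_Ioo hcc.le hdd.le
  refine ⟨Ioo a' b' ×ˢ Ioo c' d', isOpen_Ioo.prod isOpen_Ioo,
    (nonempty_Ioo.2 hab').prod (nonempty_Ioo.2 hcd'), prod_mono s1 s2, ?_⟩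
  have eF : ∀ x ∈ Ioo a' b', ∀ y ∈ Ioo c' d', F x y = f x y := by
    intro x hx y hy
    simp only [F, hαone x hx, hβone y hy, one_mul]
  have eFx : ∀ x ∈ Ioo a' b', ∀ y ∈ Ioo c' d', fx x y = Fx x y := by
    intro x hx y hy
    refine (hfx x (s1 hx) y (s2 hy)).unique ((X x y).1.congr_of_eventuallyEq ?_)
    filter_upwards [isOpen_Ioo.mem_nhds hx] with z hz using (eF z hz y hy).symm
  have eFy : ∀ x ∈ Ioo a' b', ∀ y ∈ Ioo c' d', fy x y = Fy x y := by
    intro x hx y hy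
    refine (hfy x (s1 hx) y (s2 hy)).unique ((Y x y).1.congr_of_eventuallyEq ?_)
    filter_upwards [isOpen_Ioo.mem_nhds hy] with z hz using (eF x hx z hz).symm
  filter_upwards [G] with p hp hpU
  obtain ⟨e, h1, h2⟩ := hp
  refine ⟨e, h1.congr_of_eventuallyEq ?_, h2.congr_of_eventuallyEq ?_⟩
  · filter_upwards [isOpen_Ioo.mem_nhds hpU.2] with z hz using eFx _ hpU.1 z hz
  · filter_upwards [isOpen_Ioo.mem_nhds hpU.1] with z hz using eFy z hz _ hpU.2

lemma rat_Icc_subset {U : Set ℝ} (hU : IsOpen U) (hne : U.Nonempty) :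
    ∃ p q : ℚ, (p:ℝ) < q ∧ Icc (p:ℝ) q ⊆ U := by
  obtain ⟨x, hx⟩ := hne
  obtain ⟨ε, hε, hb⟩ := Metric.isOpen_iff.1 hU x hx
  obtain ⟨p, hp1, hp2⟩ := exists_rat_btwn (by linarith : x - ε < x)
  obtain ⟨q, hq1, hq2⟩ := exists_rat_btwn (by linarith : x < x + ε)
  refine ⟨p, q, by linarith, fun z hz => hb ?_⟩
  rw [Metric.mem_ball, Real.dist_eq, abs_lt]
  constructor <;> linarith [hz.1, hz.2]

/-- A closed condition expressing that `φ` is `C^{1,1}` with constant `n` on `[p,q]`. -/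
def GoodOn (p q n : ℝ) (φ : ℝ → ℝ) : Prop :=
  ∀ x ∈ Icc p q, ∀ x' ∈ Icc p q, ∀ h, x + h ∈ Icc p q → x' + h ∈ Icc p q →
    |φ x| ≤ n ∧ |φ x - φ x'| ≤ n * |x - x'| ∧
      |(φ (x + h) - φ (x' + h)) - (φ x - φ x')| ≤ n * |x - x'| * |h|

lemma exists_goodOn {φ φ1 φ2 : ℝ → ℝ} {a b : ℝ} (hab : a < b)
    (h1 : ∀ x ∈ Icc a b, HasDerivAt φ (φ1 x) x) (h2 : ∀ x ∈ Icc a b, HasDerivAt φ1 (φ2 x) x) :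
    ∃ (p q : ℚ) (n : ℕ), a < p ∧ (p:ℝ) < q ∧ (q:ℝ) < b ∧ GoodOn p q n φ := by
  let π : ℝ → ℝ := fun x => projIcc a b hab.le x
  have hπ : Continuous π := continuous_subtype_val.comp continuous_projIcc
  have hπm : ∀ x, π x ∈ Icc a b := fun x => (projIcc a b hab.le x).2
  have hπe : ∀ x ∈ Icc a b, π x = x := fun x hx => by simp only [π, projIcc_of_mem hab.le hx]
  have c1 : ContinuousOn φ1 (Icc a b) := fun x hx => (h2 x hx).continuousAt.continuousWithinAt
  have c0 : ContinuousOn φ (Icc a b) := fun x hx => (h1 x hx).continuousAt.continuousWithinAt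
  have c1π : Continuous fun x => φ1 (π x) := c1.comp_continuous hπ hπm
  let C : ℕ → Set ℝ := fun n => {x | ∀ x' ∈ Icc a b, |φ1 x' - φ1 (π x)| ≤ n * |x' - π x|}
  have hCc : ∀ n, IsClosed (C n) := by
    intro n
    simp only [C, ofPred_forall]
    refine isClosed_iInter fun x' => isClosed_iInter fun _ => isClosed_le ?_ ?_
    · exact (continuous_const.sub c1π).abs
    · exact continuous_const.mul (continuous_const.sub hπ).abs
  have hCu : ⋃ n, C n = univ := by
    refine eq_univ_of_forall fun x0 => ?_
    have hd : ContinuousOn (dslope φ1 (π x0)) (Icc a b) := by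
      intro z hz
      apply ContinuousAt.continuousWithinAt
      by_cases hzx : z = π x0
      · rw [hzx, continuousAt_dslope_same]
        exact (h2 _ (hπm x0)).differentiableAt
      · rw [continuousAt_dslope_of_ne hzx]
        exact (h2 z hz).continuousAt
    obtain ⟨K, hK⟩ := isCompact_Icc.exists_bound_of_continuousOn hd
    obtain ⟨n, hn⟩ := exists_nat_ge K
    refine mem_iUnion.2 ⟨n, fun x' hx' => ?_⟩
    rw [← sub_smul_dslope φ1 (π x0) x', smul_eq_mul, abs_mul, mul_comm]
    gcongr
    exact (hK x' hx').trans hn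
  have hdense := dense_iUnion_interior_of_closed hCc hCu
  obtain ⟨x, hx, hxU⟩ := hdense.inter_open_nonempty (Ioo a b) isOpen_Ioo (nonempty_Ioo.2 hab)
  obtain ⟨m, hm⟩ := mem_iUnion.1 hxU
  obtain ⟨p, q, hpq, hsub⟩ := rat_Icc_subset (isOpen_Ioo.inter isOpen_interior)
    (⟨x, hx, hm⟩ : (Ioo a b ∩ interior (C m)).Nonempty)
  have hsI : Icc (p:ℝ) q ⊆ Icc a b := fun z hz => Ioo_subset_Icc_self (hsub hz).1
  obtain ⟨K0, hK0⟩ := isCompact_Icc.exists_bound_of_continuousOn c0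
  obtain ⟨K1, hK1⟩ := isCompact_Icc.exists_bound_of_continuousOn c1
  obtain ⟨n, hn⟩ := exists_nat_ge (max K0 (max K1 m))
  have n0 : K0 ≤ n := (le_max_left _ _).trans hn
  have n1 : K1 ≤ n := (le_max_left _ _).trans ((le_max_right _ _).trans hn)
  have nm : (m:ℝ) ≤ n := (le_max_right _ _).trans ((le_max_right _ _).trans hn)
  have lip : ∀ x ∈ Icc (p:ℝ) q, ∀ x' ∈ Icc (p:ℝ) q, |φ1 x' - φ1 x| ≤ n * |x' - x| := by
    intro x hx x' hx'
    have := interior_subset (hsub hx).2 x' (hsI hx')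
    rw [hπe x (hsI hx)] at this
    exact this.trans (by gcongr)
  refine ⟨p, q, n, (hsub (left_mem_Icc.2 hpq.le)).1.1, hpq, (hsub (right_mem_Icc.2 hpq.le)).1.2, ?_⟩
  intro x hx x' hx' h hxh hxh'
  refine ⟨(hK0 x (hsI hx)).trans n0, ?_, ?_⟩
  · exact Convex.norm_image_sub_le_of_norm_hasDerivWithin_le (s := Icc (p:ℝ) q) (f := φ) (f' := φ1)
      (fun w hw => (h1 w (hsI hw)).hasDerivWithinAt) (fun w hw => (hK1 w (hsI hw)).trans n1)
      (convex_Icc _ _) hx' hx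
  · have hseg : ∀ w ∈ uIcc x' x, w ∈ Icc (p:ℝ) q ∧ w + h ∈ Icc (p:ℝ) q := by
      intro w hw
      rcases le_total x' x with hle | hle
      · rw [uIcc_of_le hle] at hw
        refine ⟨⟨?_, ?_⟩, ?_, ?_⟩ <;>
          linarith [hw.1, hw.2, hx.1, hx.2, hx'.1, hx'.2, hxh.1, hxh.2, hxh'.1, hxh'.2]
      · rw [uIcc_of_ge hle] at hw
        refine ⟨⟨?_, ?_⟩, ?_, ?_⟩ <;>
          linarith [hw.1, hw.2, hx.1, hx.2, hx'.1, hx'.2, hxh.1, hxh.2, hxh'.1, hxh'.2]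
    have := Convex.norm_image_sub_le_of_norm_hasDerivWithin_le (s := uIcc x' x)
      (f := fun s => φ (s + h) - φ s) (f' := fun s => φ1 (s + h) - φ1 s) (C := n * |h|)
      (fun w hw => (((h1 _ (hsI (hseg w hw).2)).comp_add_const w h).sub
        (h1 w (hsI (hseg w hw).1))).hasDerivWithinAt)
      (fun w hw => by
        have := lip w (hseg w hw).1 (w + h) (hseg w hw).2
        rwa [add_sub_cancel_left] at this)
      (convex_uIcc _ _) left_mem_uIcc right_mem_uIcc
    rw [Real.norm_eq_abs, Real.norm_eq_abs] at this
    calc _ = |φ (x + h) - φ x - (φ (x' + h) - φ x')| := by congr 1; ring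
      _ ≤ _ := this
      _ = _ := by ring

lemma GoodOn.bounds {φ φ1 φ2 : ℝ → ℝ} {p q n : ℝ} (hn : 0 ≤ n) (hg : GoodOn p q n φ)
    (h1 : ∀ x ∈ Ioo p q, HasDerivAt φ (φ1 x) x) (h2 : ∀ x ∈ Ioo p q, HasDerivAt φ1 (φ2 x) x) :
    ∀ x ∈ Ioo p q, |φ x| ≤ n ∧ |φ1 x| ≤ n ∧ |φ2 x| ≤ n := by
  have hI : ∀ {x}, x ∈ Ioo p q → x ∈ Icc p q := fun h => Ioo_subset_Icc_self h
  have lip : ∀ x ∈ Ioo p q, ∀ x' ∈ Ioo p q, |φ1 x - φ1 x'| ≤ n * |x - x'| := by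
    intro x hx x' hx'
    have hd : HasDerivAt (fun h => φ (x + h) - φ (x' + h)) (φ1 x - φ1 x') 0 := by
      refine HasDerivAt.sub ?_ ?_
      · exact HasDerivAt.comp_const_add x 0 (by simpa using h1 x hx)
      · exact HasDerivAt.comp_const_add x' 0 (by simpa using h1 x' hx')
    refine hd.le_of_lip' (by positivity) ?_
    have t1 : Tendsto (fun h => x + h) (𝓝 0) (𝓝 x) := by
      have : Continuous fun h => x + h := by fun_prop
      simpa using this.tendsto 0
    have t2 : Tendsto (fun h => x' + h) (𝓝 0) (𝓝 x') := by
      have : Continuous fun h => x' + h := by fun_prop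
      simpa using this.tendsto 0
    filter_upwards [t1 (isOpen_Ioo.mem_nhds hx), t2 (isOpen_Ioo.mem_nhds hx')] with h hh hh'
    have := (hg x (hI hx) x' (hI hx') h (hI hh) (hI hh')).2.2
    simpa using this
  intro x hx
  refine ⟨(hg x (hI hx) x (hI hx) 0 (by simpa using hI hx) (by simpa using hI hx)).1, ?_, ?_⟩
  · refine (h1 x hx).le_of_lip' hn ?_
    filter_upwards [isOpen_Ioo.mem_nhds hx] with z hz
    exact (hg z (hI hz) x (hI hx) 0 (by simpa using hI hz) (by simpa using hI hx)).2.1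
  · refine (h2 x hx).le_of_lip' hn ?_
    filter_upwards [isOpen_Ioo.mem_nhds hx] with z hz
    exact lip z hz x hx

lemma exists_box (f fx fxx : ℝ → ℝ → ℝ) (a b c d : ℝ) (hab : a < b) (hcd : c < d)
    (hfx : ∀ x ∈ Icc a b, ∀ y ∈ Icc c d, HasDerivAt (fun t => f t y) (fx x y) x)
    (hfxx : ∀ x ∈ Icc a b, ∀ y ∈ Icc c d, HasDerivAt (fun t => fx t y) (fxx x y) x)
    (hcont : ∀ x ∈ Icc a b, ContinuousOn (fun t => f x t) (Icc c d)) :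
    ∃ a' b' c' d' n : ℝ, a ≤ a' ∧ a' < b' ∧ b' ≤ b ∧ c ≤ c' ∧ c' < d' ∧ d' ≤ d ∧ 0 ≤ n ∧
      ∀ x ∈ Ioo a' b', ∀ y ∈ Ioo c' d', |f x y| ≤ n ∧ |fx x y| ≤ n ∧ |fxx x y| ≤ n := by
  let π : ℝ → ℝ := fun x => projIcc c d hcd.le x
  have hπ : Continuous π := continuous_subtype_val.comp continuous_projIcc
  have hπm : ∀ x, π x ∈ Icc c d := fun x => (projIcc c d hcd.le x).2
  have hπe : ∀ x ∈ Icc c d, π x = x := fun x hx => by simp only [π, projIcc_of_mem hcd.le hx]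
  have hfc : ∀ x ∈ Icc a b, Continuous fun y => f x (π y) := fun x hx =>
    (hcont x hx).comp_continuous hπ hπm
  let ι := {i : ℚ × ℚ × ℕ // a ≤ i.1 ∧ (i.1:ℝ) < i.2.1 ∧ (i.2.1:ℝ) ≤ b}
  let S : ι → Set ℝ := fun i => {y | GoodOn i.1.1 i.1.2.1 i.1.2.2 (fun x => f x (π y))}
  have hSc : ∀ i, IsClosed (S i) := by
    rintro ⟨⟨p, q, n⟩, hp, hpq, hq⟩
    simp only at hp hpq hq
    have hsub : Icc (p:ℝ) q ⊆ Icc a b := Icc_subset_Icc hp hq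
    simp only [S, GoodOn, ofPred_forall]
    refine isClosed_iInter fun x => isClosed_iInter fun hx => isClosed_iInter fun x' =>
      isClosed_iInter fun hx' => isClosed_iInter fun h => isClosed_iInter fun hxh =>
      isClosed_iInter fun hxh' => ?_
    have k1 := hfc x (hsub hx)
    have k2 := hfc x' (hsub hx')
    have k3 := hfc (x + h) (hsub hxh)
    have k4 := hfc (x' + h) (hsub hxh')
    refine IsClosed.inter (isClosed_le k1.abs continuous_const)
      (IsClosed.inter (isClosed_le (k1.sub k2).abs continuous_const)
      (isClosed_le ((k3.sub k4).sub (k1.sub k2)).abs continuous_const))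
  have hSu : ⋃ i, S i = univ := by
    refine eq_univ_of_forall fun y => ?_
    obtain ⟨p, q, n, hp, hpq, hq, hg⟩ := exists_goodOn hab (fun x hx => hfx x hx (π y) (hπm y))
      (fun x hx => hfxx x hx (π y) (hπm y))
    exact mem_iUnion.2 ⟨⟨⟨p, q, n⟩, hp.le, hpq, hq.le⟩, hg⟩
  have hdense := dense_iUnion_interior_of_closed hSc hSu
  obtain ⟨y, hy, hyU⟩ := hdense.inter_open_nonempty (Ioo c d) isOpen_Ioo (nonempty_Ioo.2 hcd)
  obtain ⟨i, hi⟩ := mem_iUnion.1 hyU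
  obtain ⟨r, s, hrs, hsub⟩ := rat_Icc_subset (isOpen_Ioo.inter isOpen_interior)
    (⟨y, hy, hi⟩ : (Ioo c d ∩ interior (S i)).Nonempty)
  obtain ⟨⟨p, q, n⟩, hp, hpq, hq⟩ := i
  simp only at hp hpq hq
  refine ⟨p, q, r, s, n, hp, hpq, hq, (hsub (left_mem_Icc.2 hrs.le)).1.1.le, hrs,
    (hsub (right_mem_Icc.2 hrs.le)).1.2.le, n.cast_nonneg, fun x hx z hz => ?_⟩
  have hz' := hsub (Ioo_subset_Icc_self hz)
  have hzI : z ∈ Icc c d := Ioo_subset_Icc_self hz'.1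
  have hgood : GoodOn p q n (fun x => f x (π z)) := interior_subset hz'.2
  rw [hπe z hzI] at hgood
  have hI : ∀ x ∈ Ioo (p:ℝ) q, x ∈ Icc a b := fun x hx => ⟨hp.trans hx.1.le, hx.2.le.trans hq⟩
  exact hgood.bounds n.cast_nonneg (fun x hx => hfx x (hI x hx) z hzI)
    (fun x hx => hfxx x (hI x hx) z hzI) x hx

lemma exists_good_open (f fx fy fxx fyy : ℝ → ℝ → ℝ)
    (hfx : ∀ x ∈ Ioo (0:ℝ) 1, ∀ y ∈ Ioo (0:ℝ) 1, HasDerivAt (fun t => f t y) (fx x y) x)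
    (hfxx : ∀ x ∈ Ioo (0:ℝ) 1, ∀ y ∈ Ioo (0:ℝ) 1, HasDerivAt (fun t => fx t y) (fxx x y) x)
    (hfy : ∀ x ∈ Ioo (0:ℝ) 1, ∀ y ∈ Ioo (0:ℝ) 1, HasDerivAt (fun t => f x t) (fy x y) y)
    (hfyy : ∀ x ∈ Ioo (0:ℝ) 1, ∀ y ∈ Ioo (0:ℝ) 1, HasDerivAt (fun t => fy x t) (fyy x y) y)
    (W : Set (ℝ × ℝ)) (hW : IsOpen W) (hne : W.Nonempty) (hWs : W ⊆ Ioo (0:ℝ) 1 ×ˢ Ioo (0:ℝ) 1) :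
    ∃ U : Set (ℝ × ℝ), IsOpen U ∧ U.Nonempty ∧ U ⊆ W ∧
      ∀ᵐ p : ℝ × ℝ, p ∈ U → ∃ e : ℝ, HasDerivAt (fun t => fx p.1 t) e p.2 ∧
        HasDerivAt (fun t => fy t p.2) e p.1 := by
  obtain ⟨⟨x, y⟩, hxy⟩ := hne
  obtain ⟨u, v, hu, hv, hxu, hyv, huv⟩ := isOpen_prod_iff.1 hW x y hxy
  obtain ⟨a, b, hab, habu⟩ := rat_Icc_subset hu ⟨x, hxu⟩
  obtain ⟨c, d, hcd, hcdv⟩ := rat_Icc_subset hv ⟨y, hyv⟩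
  have hsub : Icc (a:ℝ) b ×ˢ Icc (c:ℝ) d ⊆ W := (prod_mono habu hcdv).trans huv
  have hX : ∀ x ∈ Icc (a:ℝ) b, x ∈ Ioo (0:ℝ) 1 := fun x hx =>
    (hWs (hsub (mk_mem_prod hx (left_mem_Icc.2 hcd.le)))).1
  have hY : ∀ y ∈ Icc (c:ℝ) d, y ∈ Ioo (0:ℝ) 1 := fun y hy =>
    (hWs (hsub (mk_mem_prod (left_mem_Icc.2 hab.le) hy))).2
  obtain ⟨a1, b1, c1, d1, n, ha1, hab1, hb1, hc1, hcd1, hd1, hn, B1⟩ :=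
    exists_box f fx fxx a b c d hab hcd (fun x hx y hy => hfx x (hX x hx) y (hY y hy))
      (fun x hx y hy => hfxx x (hX x hx) y (hY y hy))
      (fun x hx y hy => (hfy x (hX x hx) y (hY y hy)).continuousAt.continuousWithinAt)
  have hX1 : ∀ x ∈ Icc a1 b1, x ∈ Ioo (0:ℝ) 1 := fun x hx =>
    hX x ⟨ha1.trans hx.1, hx.2.trans hb1⟩
  have hY1 : ∀ y ∈ Icc c1 d1, y ∈ Ioo (0:ℝ) 1 := fun y hy =>
    hY y ⟨hc1.trans hy.1, hy.2.trans hd1⟩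
  obtain ⟨c2, d2, a2, b2, m, hc2, hcd2, hd2, ha2, hab2, hb2, hm, B2⟩ :=
    exists_box (fun y x => f x y) (fun y x => fy x y) (fun y x => fyy x y) c1 d1 a1 b1 hcd1 hab1
      (fun y hy x hx => hfy x (hX1 x hx) y (hY1 y hy))
      (fun y hy x hx => hfyy x (hX1 x hx) y (hY1 y hy))
      (fun y hy x hx => (hfx x (hX1 x hx) y (hY1 y hy)).continuousAt.continuousWithinAt)
  have hX2 : ∀ x ∈ Icc a2 b2, x ∈ Ioo (0:ℝ) 1 := fun x hx =>
    hX1 x ⟨ha2.trans hx.1, hx.2.trans hb2⟩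
  have hY2 : ∀ y ∈ Icc c2 d2, y ∈ Ioo (0:ℝ) 1 := fun y hy =>
    hY1 y ⟨hc2.trans hy.1, hy.2.trans hd2⟩
  have hx2 : ∀ x ∈ Ioo a2 b2, x ∈ Ioo (0:ℝ) 1 := fun x hx => hX2 x (Ioo_subset_Icc_self hx)
  have hy2 : ∀ y ∈ Ioo c2 d2, y ∈ Ioo (0:ℝ) 1 := fun y hy => hY2 y (Ioo_subset_Icc_self hy)
  have B1' : ∀ x ∈ Ioo a2 b2, ∀ y ∈ Ioo c2 d2, |f x y| ≤ n ∧ |fx x y| ≤ n ∧ |fxx x y| ≤ n :=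
    fun x hx y hy => B1 x (Ioo_subset_Ioo ha2 hb2 hx) y (Ioo_subset_Ioo hc2 hd2 hy)
  obtain ⟨U, hU, hUne, hUs, hUae⟩ := mixed_local f fx fy fxx fyy a2 b2 c2 d2 (max n m)
    (hX2 a2 (left_mem_Icc.2 hab2.le)).1.le hab2 (hX2 b2 (right_mem_Icc.2 hab2.le)).2.le
    (hY2 c2 (left_mem_Icc.2 hcd2.le)).1.le hcd2 (hY2 d2 (right_mem_Icc.2 hcd2.le)).2.le
    (hn.trans (le_max_left _ _))
    (fun x hx y hy => hfx x (hx2 x hx) y (hy2 y hy))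
    (fun x hx y hy => hfxx x (hx2 x hx) y (hy2 y hy))
    (fun x hx y hy => hfy x (hx2 x hx) y (hy2 y hy))
    (fun x hx y hy => hfyy x (hx2 x hx) y (hy2 y hy))
    (fun x hx y hy => (B1' x hx y hy).1.trans (le_max_left _ _))
    (fun x hx y hy => (B1' x hx y hy).2.1.trans (le_max_left _ _))
    (fun x hx y hy => (B1' x hx y hy).2.2.trans (le_max_left _ _))
    (fun x hx y hy => (B2 y hy x hx).2.1.trans (le_max_right _ _))
    (fun x hx y hy => (B2 y hy x hx).2.2.trans (le_max_right _ _))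
  refine ⟨U, hU, hUne, hUs.trans (Subset.trans (prod_mono ?_ ?_) hsub), hUae⟩
  · exact fun x hx => ⟨by linarith [hx.1], by linarith [hx.2]⟩
  · exact fun x hx => ⟨by linarith [hx.1], by linarith [hx.2]⟩

/-- If `f : [0,1]² → ℝ` is separately twice differentiable (with first partial
derivatives `fx`, `fy` and pure second partial derivatives `fxx`, `fyy`), then there is an
open dense subset `G = V ∩ [0,1]²` of `[0,1]²` at almost every point of which the mixed
second partial derivatives exist and are equal. -/
theorem stmt15 (f fx fy fxx fyy : ℝ → ℝ → ℝ)
    (hfx : ∀ x ∈ Icc (0:ℝ) 1, ∀ y ∈ Icc (0:ℝ) 1,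
      HasDerivWithinAt (fun t => f t y) (fx x y) (Icc (0:ℝ) 1) x)
    (hfxx : ∀ x ∈ Icc (0:ℝ) 1, ∀ y ∈ Icc (0:ℝ) 1,
      HasDerivWithinAt (fun t => fx t y) (fxx x y) (Icc (0:ℝ) 1) x)
    (hfy : ∀ x ∈ Icc (0:ℝ) 1, ∀ y ∈ Icc (0:ℝ) 1,
      HasDerivWithinAt (fun t => f x t) (fy x y) (Icc (0:ℝ) 1) y)
    (hfyy : ∀ x ∈ Icc (0:ℝ) 1, ∀ y ∈ Icc (0:ℝ) 1,
      HasDerivWithinAt (fun t => fy x t) (fyy x y) (Icc (0:ℝ) 1) y) :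
    ∃ V : Set (ℝ × ℝ), IsOpen V ∧
      (Icc (0:ℝ) 1 ×ˢ Icc (0:ℝ) 1) ⊆ closure (V ∩ (Icc (0:ℝ) 1 ×ˢ Icc (0:ℝ) 1)) ∧
      ∀ᵐ p ∂(volume.restrict (V ∩ (Icc (0:ℝ) 1 ×ˢ Icc (0:ℝ) 1))), ∃ d : ℝ,
        HasDerivWithinAt (fun t => fx p.1 t) d (Icc (0:ℝ) 1) p.2 ∧
        HasDerivWithinAt (fun t => fy t p.2) d (Icc (0:ℝ) 1) p.1 := by
  have hnh : ∀ x ∈ Ioo (0:ℝ) 1, Icc (0:ℝ) 1 ∈ 𝓝 x := fun x hx => Icc_mem_nhds hx.1 hx.2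
  have hI : ∀ x ∈ Ioo (0:ℝ) 1, x ∈ Icc (0:ℝ) 1 := fun x hx => Ioo_subset_Icc_self hx
  have key := exists_good_open f fx fy fxx fyy
    (fun x hx y hy => (hfx x (hI x hx) y (hI y hy)).hasDerivAt (hnh x hx))
    (fun x hx y hy => (hfxx x (hI x hx) y (hI y hy)).hasDerivAt (hnh x hx))
    (fun x hx y hy => (hfy x (hI x hx) y (hI y hy)).hasDerivAt (hnh y hy))
    (fun x hx y hy => (hfyy x (hI x hx) y (hI y hy)).hasDerivAt (hnh y hy))
  let P : ℝ × ℝ → Prop := fun p => ∃ e : ℝ, HasDerivAt (fun t => fx p.1 t) e p.2 ∧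
        HasDerivAt (fun t => fy t p.2) e p.1
  let 𝒰 : Set (Set (ℝ × ℝ)) := {U | IsOpen U ∧ ∀ᵐ p : ℝ × ℝ, p ∈ U → P p}
  have hopen : IsOpen (⋃₀ 𝒰) := isOpen_sUnion fun U hU => hU.1
  refine ⟨⋃₀ 𝒰, hopen, ?_, ?_⟩
  · have hcl : Icc (0:ℝ) 1 ×ˢ Icc (0:ℝ) 1 = closure (Ioo (0:ℝ) 1 ×ˢ Ioo (0:ℝ) 1) := by
      rw [closure_prod_eq, closure_Ioo zero_ne_one]
    have hmin : Ioo (0:ℝ) 1 ×ˢ Ioo (0:ℝ) 1 ⊆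
        closure (⋃₀ 𝒰 ∩ (Icc (0:ℝ) 1 ×ˢ Icc (0:ℝ) 1)) := by
      intro p hp
      rw [mem_closure_iff]
      intro o ho hpo
      obtain ⟨U, hU, hUne, hUs, hUae⟩ := key (o ∩ Ioo (0:ℝ) 1 ×ˢ Ioo (0:ℝ) 1)
        (ho.inter (isOpen_Ioo.prod isOpen_Ioo)) ⟨p, hpo, hp⟩ inter_subset_right
      obtain ⟨z, hz⟩ := hUne
      refine ⟨z, (hUs hz).1, ⟨U, ⟨hU, hUae⟩, hz⟩, ?_⟩
      exact prod_mono Ioo_subset_Icc_self Ioo_subset_Icc_self (hUs hz).2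
    calc _ = closure (Ioo (0:ℝ) 1 ×ˢ Ioo (0:ℝ) 1) := hcl
      _ ⊆ _ := closure_minimal hmin isClosed_closure
  · obtain ⟨T, hTc, hTs, hTe⟩ := TopologicalSpace.isOpen_sUnion_countable 𝒰 (fun U hU => hU.1)
    have hae : ∀ᵐ p : ℝ × ℝ, p ∈ ⋃₀ 𝒰 → P p := by
      have : ∀ᵐ p : ℝ × ℝ, ∀ U ∈ T, p ∈ U → P p :=
        (ae_ball_iff hTc).2 fun U hU => (hTs hU).2
      filter_upwards [this] with p hp hmem
      rw [← hTe] at hmem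
      obtain ⟨U, hU, hpU⟩ := hmem
      exact hp U hU hpU
    have hm : MeasurableSet (⋃₀ 𝒰 ∩ (Icc (0:ℝ) 1 ×ˢ Icc (0:ℝ) 1)) :=
      hopen.measurableSet.inter (measurableSet_Icc.prod measurableSet_Icc)
    rw [ae_restrict_iff' hm]
    filter_upwards [hae] with p hp hmem
    obtain ⟨e, h1, h2⟩ := hp hmem.1
    exact ⟨e, h1.hasDerivWithinAt, h2.hasDerivWithinAt⟩
end

section
/- There exists a function f : [0,1]² → ℝ satisfying: (i) f is separately infinitely differentiable, i.e. for every y the function x ↦ f(x,y) is infinitely differentiable on [0,1] and for every x the function y ↦ f(x,y) is infinitely differentiable on [0,1]; (ii) sup_{y ∈ [0,1]} ∫₀¹ |f''_{xx}(x,y)| dx < ∞ and sup_{x ∈ [0,1]} ∫₀¹ |f''_{yy}(x,y)| dy < ∞; (iii) there is a closed set E ⊆ [0,1]² of positive two-dimensional Lebesgue measure such that the functions (x,y) ↦ f'_x(x,y) and (x,y) ↦ f'_y(x,y) are jointly discontinuous at every point of E. -/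
open MeasureTheory Set

/-- Recursion with access to the list of all earlier values. -/
lemma exists_seq_hist {α : Type} (Q : ℕ → List α → α → Prop) (h : ∀ n l, ∃ y, Q n l y) :
    ∃ (u : ℕ → α) (L : ℕ → List α), (∀ n, Q n (L n) (u n)) ∧
      ∀ n x, x ∈ L n ↔ ∃ k < n, u k = x := by
  choose g hg using h
  let L : ℕ → List α := fun n => Nat.rec [] (fun n l => g n l :: l) n
  refine ⟨fun n => g n (L n), L, fun n => hg _ _, ?_⟩
  intro n x
  induction n with
  | zero => simp [L]
  | succ n ih =>
    have : L (n+1) = g n (L n) :: L n := rfl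
    rw [this, List.mem_cons, ih]
    constructor
    · rintro (h | ⟨k, hk, h⟩)
      · exact ⟨n, by omega, h.symm⟩
      · exact ⟨k, by omega, h⟩
    · rintro ⟨k, hk, h⟩
      rcases Nat.lt_succ_iff_lt_or_eq.1 hk with h1 | h1
      · exact Or.inr ⟨k, h1, h⟩
      · subst h1; exact Or.inl h.symm

lemma open_avoid (l : List (ℝ × ℝ × ℝ)) :
    IsOpen {p : ℝ × ℝ | ∀ z ∈ l, z.2.2 < |p.1 - z.1| ∧ z.2.2 < |p.2 - z.2.1|} := by
  induction l with
  | nil => simp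
  | cons z l ih =>
    have : {p : ℝ × ℝ | ∀ w ∈ z :: l, w.2.2 < |p.1 - w.1| ∧ w.2.2 < |p.2 - w.2.1|} =
        ({p : ℝ × ℝ | z.2.2 < |p.1 - z.1|} ∩ {p : ℝ × ℝ | z.2.2 < |p.2 - z.2.1|}) ∩
        {p : ℝ × ℝ | ∀ w ∈ l, w.2.2 < |p.1 - w.1| ∧ w.2.2 < |p.2 - w.2.1|} := by
      ext p; simp
    rw [this]
    refine IsOpen.inter (IsOpen.inter ?_ ?_) ih
    · exact isOpen_lt (by fun_prop) (by fun_prop)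
    · exact isOpen_lt (by fun_prop) (by fun_prop)

lemma exists_avoid (l : List (ℝ × ℝ × ℝ)) :
    ∃ M : ℝ, ∀ t, M ≤ t → ∀ z ∈ l, z.2.2 < |t - z.1| ∧ z.2.2 < |t - z.2.1| := by
  induction l with
  | nil => exact ⟨0, by simp⟩
  | cons z l ih =>
    obtain ⟨M, hM⟩ := ih
    refine ⟨max M (max (z.1 + z.2.2 + 1) (z.2.1 + z.2.2 + 1)), fun t ht w hw => ?_⟩
    simp only [max_le_iff] at ht
    rcases List.mem_cons.1 hw with rfl | hw
    · exact ⟨lt_of_lt_of_le (by linarith) (le_abs_self _),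
        lt_of_lt_of_le (by linarith) (le_abs_self _)⟩
    · exact hM t ht.1 w hw

lemma step_exists (B : Set (ℝ × ℝ)) (hB : IsOpen B) (ε : ℝ) (hε : 0 < ε)
    (l : List (ℝ × ℝ × ℝ)) :
    ∃ y : ℝ × ℝ × ℝ, 0 < y.2.2 ∧ y.2.2 ≤ ε ∧
      (∀ q ∈ Metric.closedBall (y.1, y.2.1) y.2.2,
        ∀ z ∈ l, z.2.2 < |q.1 - z.1| ∧ z.2.2 < |q.2 - z.2.1|) ∧
      ((∃ p ∈ B, ∀ z ∈ l, z.2.2 < |p.1 - z.1| ∧ z.2.2 < |p.2 - z.2.1|) →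
        Metric.closedBall (y.1, y.2.1) y.2.2 ⊆ B) := by
  have key : ∀ G : Set (ℝ × ℝ), IsOpen G → ∀ p ∈ G,
      ∃ y : ℝ × ℝ × ℝ, 0 < y.2.2 ∧ y.2.2 ≤ ε ∧
        Metric.closedBall (y.1, y.2.1) y.2.2 ⊆ G := by
    intro G hG p hp
    obtain ⟨δ, hδ, hsub⟩ := Metric.nhds_basis_closedBall.mem_iff.1 (hG.mem_nhds hp)
    exact ⟨(p.1, p.2, min δ ε), lt_min hδ hε, min_le_right _ _,
      (Metric.closedBall_subset_closedBall (min_le_left _ _)).trans hsub⟩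
  by_cases hex : ∃ p ∈ B, ∀ z ∈ l, z.2.2 < |p.1 - z.1| ∧ z.2.2 < |p.2 - z.2.1|
  · obtain ⟨p, hp, hpl⟩ := hex
    obtain ⟨y, h1, h2, h3⟩ := key _ (hB.inter (open_avoid l)) p ⟨hp, hpl⟩
    exact ⟨y, h1, h2, fun q hq => (h3 hq).2, fun _ => fun q hq => (h3 hq).1⟩
  · obtain ⟨M, hM⟩ := exists_avoid l
    obtain ⟨y, h1, h2, h3⟩ := key _ (open_avoid l) (M, M) (hM M le_rfl)
    exact ⟨y, h1, h2, fun q hq => h3 hq, fun h => absurd h hex⟩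

/-- The geometric configuration of squares. -/
lemma exists_config : ∃ a b r : ℕ → ℝ, (∀ n, 0 < r n) ∧ (∀ n, r n ≤ 1/32 * (1/2)^n) ∧
    (∀ m n x, m ≠ n → |x - a m| < r m → |x - a n| < r n → False) ∧
    (∀ m n x, m ≠ n → |x - b m| < r m → |x - b n| < r n → False) ∧
    (∀ p : ℝ × ℝ, (∀ n, r n < |p.1 - a n| ∧ r n < |p.2 - b n|) → ∀ W ∈ nhds p,
      ∃ n, ∀ x y, |x - a n| ≤ r n → |y - b n| ≤ r n → (x, y) ∈ W) := by
  have hcb := TopologicalSpace.isBasis_countableBasis (ℝ × ℝ)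
  obtain ⟨B, hB⟩ := (TopologicalSpace.countable_countableBasis (ℝ × ℝ)).exists_eq_range
    (by
      obtain ⟨V, hV, _⟩ := hcb.mem_nhds_iff.1 (Filter.univ_mem (f := nhds (0 : ℝ × ℝ)))
      exact ⟨V, hV⟩)
  have hBo : ∀ n, IsOpen (B n) := fun n => hcb.isOpen (hB ▸ mem_range_self n)
  obtain ⟨u, L, hQ, hL⟩ := exists_seq_hist _
    (fun n l => step_exists (B n) (hBo n) (1/32 * (1/2)^n) (by positivity) l)
  have hball : ∀ n x y, |x - (u n).1| ≤ (u n).2.2 → |y - (u n).2.1| ≤ (u n).2.2 →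
      (x, y) ∈ Metric.closedBall ((u n).1, (u n).2.1) (u n).2.2 := by
    intro n x y hx hy
    rw [Metric.mem_closedBall, Prod.dist_eq]
    simpa [Real.dist_eq] using And.intro hx hy
  have hsep : ∀ m n, m < n → ∀ x y, |x - (u n).1| ≤ (u n).2.2 → |y - (u n).2.1| ≤ (u n).2.2 →
      (u m).2.2 < |x - (u m).1| ∧ (u m).2.2 < |y - (u m).2.1| := by
    intro m n hmn x y hx hy
    exact (hQ n).2.2.1 _ (hball n x y hx hy) (u m) ((hL n _).2 ⟨m, hmn, rfl⟩)
  have hpos : ∀ n, 0 < (u n).2.2 := fun n => (hQ n).1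
  refine ⟨fun n => (u n).1, fun n => (u n).2.1, fun n => (u n).2.2, hpos,
    fun n => (hQ n).2.1, ?_, ?_, ?_⟩
  · intro m n x hmn h1 h2
    rcases lt_or_gt_of_ne hmn with h | h
    · exact absurd (hsep m n h x (u n).2.1 h2.le (by simpa using (hpos n).le)).1 (by linarith)
    · exact absurd (hsep n m h x (u m).2.1 h1.le (by simpa using (hpos m).le)).1 (by linarith)
  · intro m n x hmn h1 h2
    rcases lt_or_gt_of_ne hmn with h | h
    · exact absurd (hsep m n h (u n).1 x (by simpa using (hpos n).le) h2.le).2 (by linarith)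
    · exact absurd (hsep n m h (u m).1 x (by simpa using (hpos m).le) h1.le).2 (by linarith)
  · intro p hp W hW
    obtain ⟨V, hV, hpV, hVW⟩ := hcb.mem_nhds_iff.1 hW
    rw [hB] at hV
    obtain ⟨n, rfl⟩ := hV
    refine ⟨n, fun x y hx hy => hVW ((hQ n).2.2.2 ⟨p, hpV, fun z hz => ?_⟩ (hball n x y hx hy))⟩
    obtain ⟨k, _, rfl⟩ := (hL n z).1 hz
    exact hp k

lemma vol_pos (a r : ℕ → ℝ) (hr : ∀ n, 0 < r n) (hr2 : ∀ n, r n ≤ 1/32 * (1/2)^n) :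
    0 < volume (Icc (1/4:ℝ) (3/4) \ ⋃ n, Ioo (a n - 2 * r n) (a n + 2 * r n)) := by
  rw [pos_iff_ne_zero]
  intro h0
  have h1 : volume (Icc (1/4:ℝ) (3/4)) ≤
      volume (Icc (1/4:ℝ) (3/4) \ ⋃ n, Ioo (a n - 2 * r n) (a n + 2 * r n)) +
      volume (⋃ n, Ioo (a n - 2 * r n) (a n + 2 * r n)) := by
    refine (measure_mono ?_).trans (measure_union_le _ _)
    intro x hx
    by_cases h : x ∈ ⋃ n, Ioo (a n - 2 * r n) (a n + 2 * r n)
    · exact Or.inr h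
    · exact Or.inl ⟨hx, h⟩
  have hs : Summable (fun n : ℕ => 1/8 * (1/2:ℝ)^n) := summable_geometric_two.mul_left _
  have h2 : volume (⋃ n, Ioo (a n - 2 * r n) (a n + 2 * r n)) ≤ ENNReal.ofReal (1/4) := by
    calc _ ≤ ∑' n, volume (Ioo (a n - 2 * r n) (a n + 2 * r n)) := measure_iUnion_le _
      _ ≤ ∑' n : ℕ, ENNReal.ofReal (1/8 * (1/2:ℝ)^n) := by
        refine ENNReal.tsum_le_tsum fun n => ?_
        rw [Real.volume_Ioo]
        exact ENNReal.ofReal_le_ofReal (by linarith [hr2 n])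
      _ = ENNReal.ofReal (∑' n : ℕ, (1/8 * (1/2:ℝ)^n)) :=
        (ENNReal.ofReal_tsum_of_nonneg (fun n => by positivity) hs).symm
      _ = _ := by rw [tsum_mul_left, tsum_geometric_two]; norm_num
  rw [h0, zero_add, Real.volume_Icc] at h1
  have h3 := h1.trans h2
  rw [ENNReal.ofReal_le_ofReal_iff (by norm_num)] at h3
  norm_num at h3

lemma exists_phi : ∃ φ : ℝ → ℝ, ContDiff ℝ (⊤ : ℕ∞) φ ∧ φ 0 = 1 ∧
    (∀ x, 1 ≤ |x| → φ x = 0) ∧ (∀ x, |φ x| ≤ 1) ∧ deriv φ 0 = 0 ∧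
    (∃ t, |t| ≤ 1 ∧ deriv φ t = -1) ∧ ∃ M, 0 ≤ M ∧ ∀ x, |deriv (deriv φ) x| ≤ M := by
  let φ : ContDiffBump (0:ℝ) := ⟨1/2, 1, by norm_num, by norm_num⟩
  have hc : ContDiff ℝ (⊤ : ℕ∞) φ := φ.contDiff
  have hz : ∀ x, 1 ≤ |x| → φ x = 0 := fun x hx => φ.zero_of_le_dist (by simpa [φ] using hx)
  have h0 : φ 0 = 1 := φ.one_of_mem_closedBall (by simp [φ])
  refine ⟨φ, hc, h0, hz, fun x => ?_, ?_, ?_, ?_⟩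
  · rw [abs_of_nonneg φ.nonneg]; exact φ.le_one
  · have : IsLocalMax φ 0 := Filter.Eventually.of_forall fun x => by rw [h0]; exact φ.le_one
    exact this.deriv_eq_zero
  · obtain ⟨t, ht, h⟩ := exists_deriv_eq_slope φ (zero_lt_one' ℝ) hc.continuous.continuousOn
      (hc.differentiable (by simp)).differentiableOn
    refine ⟨t, by rw [abs_le]; constructor <;> linarith [ht.1, ht.2], ?_⟩
    rw [h, h0, hz 1 (by simp)]; norm_num
  · have hcs : HasCompactSupport (deriv (deriv φ)) := φ.hasCompactSupport.deriv.deriv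
    have hcont : Continuous (deriv (deriv φ)) := by
      have h1 : ContDiff ℝ (⊤ : ℕ∞) (deriv φ) := (contDiff_infty_iff_deriv.1 hc).2
      exact (contDiff_infty_iff_deriv.1 h1).2.continuous
    obtain ⟨M, hM⟩ := hcs.exists_bound_of_continuous hcont
    exact ⟨M, (norm_nonneg _).trans (hM 0), hM⟩

lemma dd_zero (φ : ℝ → ℝ) (hz : ∀ x, 1 ≤ |x| → φ x = 0) (x : ℝ) (hx : 1 < |x|) :
    deriv (deriv φ) x = 0 := by
  have h : φ =ᶠ[nhds x] fun _ => 0 := by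
    filter_upwards [(isOpen_lt continuous_const continuous_abs).mem_nhds hx] with y hy
    exact hz y (le_of_lt hy)
  have := h.deriv.deriv_eq
  simpa using this

/-- One-dimensional slice. -/
lemma slice_deriv (φ : ℝ → ℝ) (hc : ContDiff ℝ (⊤ : ℕ∞) φ) (r a C : ℝ) (hr : 0 < r) (x : ℝ) :
    HasDerivAt (fun x => r * φ ((x - a) / r) * C) (deriv φ ((x - a) / r) * C) x := by
  have h1 : HasDerivAt (fun x => (x - a) / r) (1 / r) x :=
    ((hasDerivAt_id x).sub_const a).div_const r
  have h2 := (hc.differentiable (by simp) ((x - a) / r)).hasDerivAt.comp x h1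
  have h3 := (h2.const_mul r).mul_const C
  refine h3.congr_deriv ?_
  field_simp

lemma slice_deriv2 (φ : ℝ → ℝ) (hc : ContDiff ℝ (⊤ : ℕ∞) φ) (r a C : ℝ) (x : ℝ) :
    HasDerivAt (fun x => deriv φ ((x - a) / r) * C) (deriv (deriv φ) ((x - a) / r) * (1 / r) * C)
      x := by
  have h1 : HasDerivAt (fun x => (x - a) / r) (1 / r) x :=
    ((hasDerivAt_id x).sub_const a).div_const r
  have h0 : ContDiff ℝ (⊤ : ℕ∞) (deriv φ) := (contDiff_infty_iff_deriv.1 hc).2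
  exact ((h0.differentiable (by simp) ((x - a) / r)).hasDerivAt.comp x h1).mul_const C

lemma slice_deriv_within (φ : ℝ → ℝ) (hc : ContDiff ℝ (⊤ : ℕ∞) φ) (r a C : ℝ) (hr : 0 < r)
    (x : ℝ) (hx : x ∈ Icc (0:ℝ) 1) :
    derivWithin (fun x => r * φ ((x - a) / r) * C) (Icc (0:ℝ) 1) x =
      deriv φ ((x - a) / r) * C :=
  (slice_deriv φ hc r a C hr x).hasDerivWithinAt.derivWithin (uniqueDiffOn_Icc zero_lt_one x hx)

lemma slice_bound (φ : ℝ → ℝ) (hc : ContDiff ℝ (⊤ : ℕ∞) φ) (hz : ∀ x, 1 ≤ |x| → φ x = 0)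
    (M : ℝ) (hM0 : 0 ≤ M) (hM : ∀ x, |deriv (deriv φ) x| ≤ M)
    (r a C : ℝ) (hr : 0 < r) (hC : |C| ≤ 1) :
    (∫⁻ x in Icc (0:ℝ) 1, ENNReal.ofReal
        |derivWithin (fun t => derivWithin (fun s => r * φ ((s - a) / r) * C) (Icc (0:ℝ) 1) t)
          (Icc (0:ℝ) 1) x|) ≤ ENNReal.ofReal (2 * M) := by
  calc _ ≤ ∫⁻ x in Icc (0:ℝ) 1,
        (Icc (a - r) (a + r)).indicator (fun _ => ENNReal.ofReal (M / r)) x := by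
        refine setLIntegral_mono' measurableSet_Icc fun x hx => ?_
        rw [derivWithin_congr (fun t ht => slice_deriv_within φ hc r a C hr t ht)
          (slice_deriv_within φ hc r a C hr x hx),
          (slice_deriv2 φ hc r a C x).hasDerivWithinAt.derivWithin
            (uniqueDiffOn_Icc zero_lt_one x hx)]
        by_cases hxx : x ∈ Icc (a - r) (a + r)
        · rw [indicator_of_mem hxx]
          apply ENNReal.ofReal_le_ofReal
          rw [abs_mul, abs_mul, abs_of_pos (by positivity : 0 < 1 / r)]
          calc _ ≤ M * (1 / r) * 1 := by gcongr; exact hM _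
            _ = _ := by ring
        · rw [dd_zero φ hz]
          · simp
          · rw [abs_div, abs_of_pos hr, lt_div_iff₀ hr, one_mul]
            by_contra! h
            rw [abs_le] at h
            exact hxx ⟨by linarith [h.1], by linarith [h.2]⟩
    _ ≤ ∫⁻ x, (Icc (a - r) (a + r)).indicator (fun _ => ENNReal.ofReal (M / r)) x :=
        setLIntegral_le_lintegral _ _
    _ = ENNReal.ofReal (M / r) * ENNReal.ofReal (2 * r) := by
        rw [lintegral_indicator_const measurableSet_Icc, Real.volume_Icc]
        congr 2; ring
    _ = _ := by
        rw [← ENNReal.ofReal_mul (by positivity)]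
        congr 1; field_simp

/-- The function. -/
noncomputable def bumpSum (φ : ℝ → ℝ) (a b r : ℕ → ℝ) (x y : ℝ) : ℝ :=
  ∑' n, r n * φ ((x - a n) / r n) * φ ((y - b n) / r n)

lemma bumpSum_swap (φ : ℝ → ℝ) (a b r : ℕ → ℝ) (x y : ℝ) :
    bumpSum φ a b r x y = bumpSum φ b a r y x := by
  unfold bumpSum
  congr 1; ext n; ring

lemma phi_zero (φ : ℝ → ℝ) (hz : ∀ x, 1 ≤ |x| → φ x = 0) (b r y : ℝ) (hr : 0 < r)
    (h : ¬ |y - b| < r) : φ ((y - b) / r) = 0 := by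
  apply hz
  rw [abs_div, abs_of_pos hr, le_div_iff₀ hr, one_mul]
  exact not_lt.1 h

lemma bumpSum_slice_of (φ : ℝ → ℝ) (hz : ∀ x, 1 ≤ |x| → φ x = 0) (a b r : ℕ → ℝ)
    (hr : ∀ n, 0 < r n)
    (hb : ∀ m n x, m ≠ n → |x - b m| < r m → |x - b n| < r n → False) (y : ℝ) (n : ℕ)
    (hn : |y - b n| < r n) :
    (fun x => bumpSum φ a b r x y) =
      fun x => r n * φ ((x - a n) / r n) * φ ((y - b n) / r n) := by
  ext x
  unfold bumpSum
  rw [tsum_eq_single n]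
  intro m hm
  rw [phi_zero φ hz (b m) (r m) y (hr m) (fun h => hb m n y hm h hn), mul_zero]

lemma bumpSum_slice (φ : ℝ → ℝ) (hz : ∀ x, 1 ≤ |x| → φ x = 0) (h1 : ∀ x, |φ x| ≤ 1)
    (a b r : ℕ → ℝ) (hr : ∀ n, 0 < r n)
    (hb : ∀ m n x, m ≠ n → |x - b m| < r m → |x - b n| < r n → False) (y : ℝ) :
    ∃ s c C : ℝ, 0 < s ∧ |C| ≤ 1 ∧
    (fun x => bumpSum φ a b r x y) = fun x => s * φ ((x - c) / s) * C := by
  by_cases h : ∃ n, |y - b n| < r n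
  · obtain ⟨n, hn⟩ := h
    exact ⟨r n, a n, _, hr n, h1 _, bumpSum_slice_of φ hz a b r hr hb y n hn⟩
  · push Not at h
    refine ⟨1, 0, 0, one_pos, by simp, ?_⟩
    ext x
    unfold bumpSum
    have : ∀ n, r n * φ ((x - a n) / r n) * φ ((y - b n) / r n) = 0 := fun n => by
      rw [phi_zero φ hz (b n) (r n) y (hr n) (not_lt.2 (h n)), mul_zero]
    simp [this]

lemma bumpSum_smooth (φ : ℝ → ℝ) (hc : ContDiff ℝ (⊤ : ℕ∞) φ)
    (hz : ∀ x, 1 ≤ |x| → φ x = 0) (h1 : ∀ x, |φ x| ≤ 1)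
    (a b r : ℕ → ℝ) (hr : ∀ n, 0 < r n)
    (hb : ∀ m n x, m ≠ n → |x - b m| < r m → |x - b n| < r n → False) (y : ℝ) :
    ContDiffOn ℝ (⊤ : ℕ∞) (fun x => bumpSum φ a b r x y) (Icc (0:ℝ) 1) := by
  obtain ⟨s, c, C, hs, hC, h⟩ := bumpSum_slice φ hz h1 a b r hr hb y
  rw [h]
  apply ContDiff.contDiffOn
  have : ContDiff ℝ (⊤ : ℕ∞) fun x : ℝ => φ ((x - c) / s) :=
    hc.comp ((contDiff_id.sub contDiff_const).div_const s)
  exact (contDiff_const.mul this).mul contDiff_const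

lemma bumpSum_L1 (φ : ℝ → ℝ) (hc : ContDiff ℝ (⊤ : ℕ∞) φ)
    (hz : ∀ x, 1 ≤ |x| → φ x = 0) (h1 : ∀ x, |φ x| ≤ 1)
    (M : ℝ) (hM0 : 0 ≤ M) (hM : ∀ x, |deriv (deriv φ) x| ≤ M)
    (a b r : ℕ → ℝ) (hr : ∀ n, 0 < r n)
    (hb : ∀ m n x, m ≠ n → |x - b m| < r m → |x - b n| < r n → False) :
    (⨆ y ∈ Icc (0:ℝ) 1, ∫⁻ x in Icc (0:ℝ) 1, ENNReal.ofReal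
        |derivWithin (fun t => derivWithin (fun s => bumpSum φ a b r s y) (Icc (0:ℝ) 1) t)
          (Icc (0:ℝ) 1) x|) < ⊤ := by
  refine lt_of_le_of_lt (iSup₂_le fun y _ => ?_) (ENNReal.ofReal_lt_top (r := 2 * M))
  obtain ⟨s, c, C, hs, hC, h⟩ := bumpSum_slice φ hz h1 a b r hr hb y
  rw [h]
  exact slice_bound φ hc hz M hM0 hM s c C hs hC

lemma bumpSum_disc (φ : ℝ → ℝ) (hc : ContDiff ℝ (⊤ : ℕ∞) φ) (h0 : φ 0 = 1)
    (hz : ∀ x, 1 ≤ |x| → φ x = 0) (hd0 : deriv φ 0 = 0)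
    (t : ℝ) (ht : |t| ≤ 1) (hdt : deriv φ t = -1)
    (a b r : ℕ → ℝ) (hr : ∀ n, 0 < r n)
    (hb : ∀ m n x, m ≠ n → |x - b m| < r m → |x - b n| < r n → False)
    (p : ℝ × ℝ) (hp : Icc (0:ℝ) 1 ×ˢ Icc (0:ℝ) 1 ∈ nhds p)
    (hacc : ∀ W ∈ nhds p,
      ∃ n, ∀ x y, |x - a n| ≤ r n → |y - b n| ≤ r n → (x, y) ∈ W) :
    ¬ ContinuousWithinAt
        (fun q : ℝ × ℝ => derivWithin (fun s => bumpSum φ a b r s q.2) (Icc (0:ℝ) 1) q.1)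
        (Icc (0:ℝ) 1 ×ˢ Icc (0:ℝ) 1) p := by
  intro hcont
  have hcont := hcont.continuousAt hp
  have hW := Filter.inter_mem hp (Metric.continuousAt_iff'.1 hcont (1/2) (by norm_num))
  obtain ⟨n, hn⟩ := hacc _ hW
  have hrn := hr n
  have hsl := bumpSum_slice_of φ hz a b r hr hb (b n) n (by simpa using hrn)
  have q1 := hn (a n) (b n) (by simpa using hrn.le) (by simpa using hrn.le)
  have q2 := hn (a n + r n * t) (b n)
    (by rw [add_sub_cancel_left, abs_mul, abs_of_pos hrn]; nlinarith) (by simpa using hrn.le)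
  have e1 := q1.2
  have e2 := q2.2
  simp only [mem_setOf_eq] at e1 e2
  rw [hsl, slice_deriv_within φ hc _ _ _ hrn _ q1.1.1] at e1
  rw [hsl, slice_deriv_within φ hc _ _ _ hrn _ q2.1.1] at e2
  have e3 : (a n + r n * t - a n) / r n = t := by field_simp; ring
  rw [e3, hdt, sub_self, zero_div, h0] at e2
  rw [sub_self, zero_div, hd0, zero_mul] at e1
  rw [Real.dist_eq, abs_lt] at e1 e2
  linarith [e1.1, e1.2, e2.1, e2.2]

/-- There exists `f : [0,1]² → ℝ` which is separately infinitely
differentiable, whose second pure partial derivatives have uniformly bounded `L¹`-norms on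
the corresponding segments, and whose first partial derivatives are jointly discontinuous at
every point of some closed set `E ⊆ [0,1]²` of positive measure. -/
theorem stmt16 : ∃ f : ℝ → ℝ → ℝ,
    (∀ y ∈ Icc (0:ℝ) 1, ContDiffOn ℝ (⊤ : ℕ∞) (fun x => f x y) (Icc (0:ℝ) 1)) ∧
    (∀ x ∈ Icc (0:ℝ) 1, ContDiffOn ℝ (⊤ : ℕ∞) (fun y => f x y) (Icc (0:ℝ) 1)) ∧
    (⨆ y ∈ Icc (0:ℝ) 1, ∫⁻ x in Icc (0:ℝ) 1, ENNReal.ofReal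
        |derivWithin (fun t => derivWithin (fun s => f s y) (Icc (0:ℝ) 1) t)
          (Icc (0:ℝ) 1) x|) < ⊤ ∧
    (⨆ x ∈ Icc (0:ℝ) 1, ∫⁻ y in Icc (0:ℝ) 1, ENNReal.ofReal
        |derivWithin (fun t => derivWithin (fun s => f x s) (Icc (0:ℝ) 1) t)
          (Icc (0:ℝ) 1) y|) < ⊤ ∧
    ∃ E : Set (ℝ × ℝ), E ⊆ Icc (0:ℝ) 1 ×ˢ Icc (0:ℝ) 1 ∧ IsClosed E ∧ 0 < volume E ∧
      ∀ p ∈ E,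
        ¬ ContinuousWithinAt
            (fun q : ℝ × ℝ => derivWithin (fun s => f s q.2) (Icc (0:ℝ) 1) q.1)
            (Icc (0:ℝ) 1 ×ˢ Icc (0:ℝ) 1) p ∧
        ¬ ContinuousWithinAt
            (fun q : ℝ × ℝ => derivWithin (fun s => f q.1 s) (Icc (0:ℝ) 1) q.2)
            (Icc (0:ℝ) 1 ×ˢ Icc (0:ℝ) 1) p := by
  obtain ⟨φ, hc, h0, hz, h1, hd0, ⟨t, ht, hdt⟩, M, hM0, hM⟩ := exists_phi
  obtain ⟨a, b, r, hr, hr2, ha, hb, hacc⟩ := exists_config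
  have hsw : ∀ x, (fun y => bumpSum φ a b r x y) = fun y => bumpSum φ b a r y x :=
    fun x => funext fun y => bumpSum_swap φ a b r x y
  refine ⟨bumpSum φ a b r, fun y _ => bumpSum_smooth φ hc hz h1 a b r hr hb y, fun x _ => ?_,
    bumpSum_L1 φ hc hz h1 M hM0 hM a b r hr hb, ?_,
    (Icc (1/4:ℝ) (3/4) \ ⋃ n, Ioo (a n - 2 * r n) (a n + 2 * r n)) ×ˢ
    (Icc (1/4:ℝ) (3/4) \ ⋃ n, Ioo (b n - 2 * r n) (b n + 2 * r n)), ?_, ?_, ?_, ?_⟩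
  · rw [hsw]; exact bumpSum_smooth φ hc hz h1 b a r hr ha x
  · simp_rw [hsw]; exact bumpSum_L1 φ hc hz h1 M hM0 hM b a r hr ha
  · refine prod_mono ?_ ?_ <;>
    exact diff_subset.trans (Icc_subset_Icc (by norm_num) (by norm_num))
  · exact (isClosed_Icc.sdiff (isOpen_iUnion fun n => isOpen_Ioo)).prod
      (isClosed_Icc.sdiff (isOpen_iUnion fun n => isOpen_Ioo))
  · rw [Measure.volume_eq_prod, Measure.prod_prod]
    exact ENNReal.mul_pos (vol_pos a r hr hr2).ne' (vol_pos b r hr hr2).ne'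
  · rintro ⟨x, y⟩ ⟨⟨hx, hxU⟩, ⟨hy, hyU⟩⟩
    simp only at hx hxU hy hyU
    have hfar : ∀ (c : ℕ → ℝ) (z : ℝ), z ∉ ⋃ n, Ioo (c n - 2 * r n) (c n + 2 * r n) →
        ∀ n, r n < |z - c n| := by
      intro c z hzU n
      by_contra! h
      rw [abs_le] at h
      exact hzU (mem_iUnion.2 ⟨n, by linarith [h.1, hr n], by linarith [h.2, hr n]⟩)
    have hI : ∀ z ∈ Icc (1/4:ℝ) (3/4), Icc (0:ℝ) 1 ∈ nhds z := fun z hz =>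
      Icc_mem_nhds (by linarith [hz.1]) (by linarith [hz.2])
    have hac := hacc (x, y) (fun n => ⟨hfar a x hxU n, hfar b y hyU n⟩)
    refine ⟨bumpSum_disc φ hc h0 hz hd0 t ht hdt a b r hr hb (x, y)
      (prod_mem_nhds (hI x hx) (hI y hy)) hac, ?_⟩
    simp_rw [hsw]
    have hD := bumpSum_disc φ hc h0 hz hd0 t ht hdt b a r hr ha (y, x)
      (prod_mem_nhds (hI y hy) (hI x hx)) (fun W hW => by
        obtain ⟨n, hn⟩ := hac (Prod.swap ⁻¹' W) (continuous_swap.continuousAt.preimage_mem_nhds hW)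
        exact ⟨n, fun u v hu hv => hn v u hv hu⟩)
    intro hcon
    apply hD
    have hS : ContinuousWithinAt (Prod.swap : ℝ × ℝ → ℝ × ℝ) (Icc (0:ℝ) 1 ×ˢ Icc (0:ℝ) 1)
      (y, x) := continuous_swap.continuousWithinAt
    exact ContinuousWithinAt.comp (x := ((y, x) : ℝ × ℝ)) (f := Prod.swap) hcon hS
      (fun q hq => ⟨hq.2, hq.1⟩)
end
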